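/- arXiv:0905.2293 — 3 statements merged into one kernel-verified Lean document; each statement's English description precedes it below -/
import Mathlib

section
/- For every monic centered polynomial P(z) = z^d + a_{d−2}z^{d−2} + ⋯ + a₁z + a₀ of degree d ≥ 2, there exist R > 0 and a holomorphic injective map φ on {z ∈ ℂ : |z| > R} with φ(z)/z → 1 as z → ∞, such that φ'(z)·P(z) = (φ(z))^d for all |z| > R. Moreover φ is unique as a germ at infinity: if φ₁ on {|z| > R₁} and φ₂ on {|z| > R₂} are two such maps, then φ₁ = φ₂ on {|z| > max(R₁, R₂)}. -/
open Filter

lemma aux_local_inj {f : ℂ → ℂ} {f' a : ℂ} (hf : HasStrictDerivAt f f' a) (h0 : f' ≠ 0) :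
    ∃ s ∈ nhds a, Set.InjOn f s := by
  refine ⟨_, hf.eventually_left_inverse h0, ?_⟩
  intro x hx y hy hxy
  have hx' : hf.localInverse f f' a h0 (f x) = x := hx
  have hy' : hf.localInverse f f' a h0 (f y) = y := hy
  rw [← hx', ← hy', hxy]

lemma aux_preconn (R : ℝ) (hR : 0 < R) : IsPreconnected {z : ℂ | R < ‖z‖} := by
  have h1 : IsPreconnected {z : ℂ | Real.log R < z.re} :=
    (convex_halfSpace_re_gt _).isPreconnected
  have h2 := h1.image Complex.exp Complex.continuous_exp.continuousOn
  convert h2 using 1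
  ext z
  simp only [Set.mem_ofPred_eq, Set.mem_image]
  constructor
  · intro hz
    have hz0 : z ≠ 0 := by
      rintro rfl
      simp at hz; linarith
    refine ⟨Complex.log z, ?_, Complex.exp_log hz0⟩
    rw [Complex.log_re]
    exact Real.log_lt_log hR hz
  · rintro ⟨w, hw, rfl⟩
    rw [Complex.norm_exp]
    exact (Real.log_lt_iff_lt_exp hR).1 hw

lemma aux_open (R : ℝ) : IsOpen {z : ℂ | R < ‖z‖} :=
  isOpen_lt continuous_const continuous_norm

lemma aux_cob {p : ℂ → Prop} (h : ∀ᶠ z in Bornology.cobounded ℂ, p z) :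
    ∃ R : ℝ, 0 < R ∧ ∀ z, R < ‖z‖ → p z := by
  rw [← comap_norm_atTop] at h
  obtain ⟨s, hs, hsub⟩ := mem_comap.1 h
  obtain ⟨R, hR⟩ := mem_atTop_sets.1 hs
  refine ⟨max R 1, by positivity, fun z hz => hsub ?_⟩
  exact hR _ ((le_max_left _ _).trans hz.le)

lemma aux_cob' (R : ℝ) : ∀ᶠ z in Bornology.cobounded ℂ, R < ‖z‖ :=
  tendsto_norm_cobounded_atTop.eventually_gt_atTop R

/-- Primitive of `(m+1) w^m g` vanishing at zero, divided by `w^(m+1)`. -/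
lemma aux_prim (m : ℕ) (g : ℂ → ℂ) (hg : AnalyticAt ℂ g 0) (hg0 : g 0 = 1) :
    ∃ H : ℂ → ℂ, AnalyticAt ℂ H 0 ∧ H 0 = 1 ∧
      ∀ᶠ w in nhds (0:ℂ), HasDerivAt (fun w => w ^ (m+1) * H w) ((m+1) * w ^ m * g w) w := by
  obtain ⟨r, hr, hball⟩ := Metric.eventually_nhds_iff_ball.1 hg.eventually_analyticAt
  have hdiff : DifferentiableOn ℂ (fun w => ((m:ℂ)+1) * w ^ m * g w) (Metric.ball 0 r) := by
    intro w hw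
    have := (hball w hw).differentiableAt
    apply DifferentiableAt.differentiableWithinAt
    fun_prop
  obtain ⟨G, hG0, hG⟩ := hdiff.isExactOn_ball.with_val_at 0 0
  have hGev : ∀ᶠ w in nhds (0:ℂ), HasDerivAt G ((m+1) * w ^ m * g w) w :=
    Filter.eventually_of_mem (Metric.ball_mem_nhds 0 hr) hG
  have hGan : AnalyticAt ℂ G 0 := by
    refine DifferentiableOn.analyticAt (s := Metric.ball 0 r) ?_ (Metric.ball_mem_nhds 0 hr)
    intro w hw
    exact (hG w hw).differentiableAt.differentiableWithinAt
  have hm : ((m:ℂ)+1) ≠ 0 := by exact_mod_cast Nat.succ_ne_zero m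
  have hord : analyticOrderAt (deriv G) 0 = m := by
    rw [hGan.deriv.analyticOrderAt_eq_natCast]
    refine ⟨fun w => (m+1) * g w, by fun_prop, by simp [hg0, hm], ?_⟩
    filter_upwards [hGev] with w hw
    rw [hw.deriv, smul_eq_mul, sub_zero]; ring
  have hord2 : analyticOrderAt G 0 = ((m+1 : ℕ) : ℕ∞) := by
    have := hGan.analyticOrderAt_deriv_add_one
    simp only [hG0, sub_zero] at this
    rw [← this, hord]; push_cast; rfl
  obtain ⟨H, hH, -, hGH⟩ := hGan.analyticOrderAt_eq_natCast.1 hord2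
  have hder : ∀ᶠ w in nhds (0:ℂ), HasDerivAt (fun w => w ^ (m+1) * H w) ((m+1) * w ^ m * g w) w := by
    filter_upwards [hGev, hGH.eventually_nhds] with w hw hw2
    refine hw.congr_of_eventuallyEq ?_
    filter_upwards [hw2] with u hu
    rw [hu, smul_eq_mul, sub_zero]
  refine ⟨H, hH, ?_, hder⟩
  have hlim : ∀ᶠ w in nhdsWithin (0:ℂ) {0}ᶜ, (m+1) * H w + w * deriv H w = (m+1) * g w := by
    rw [eventually_nhdsWithin_iff]
    filter_upwards [hder, hH.eventually_analyticAt] with w hw hHw hw0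
    have hw0' : w ≠ 0 := hw0
    have h1 := (hasDerivAt_pow (m+1) w).mul hHw.differentiableAt.hasDerivAt
    have h2 := hw.unique h1
    have h3 : w ^ m ≠ 0 := pow_ne_zero _ hw0'
    apply mul_left_cancel₀ h3
    push_cast at h2
    linear_combination -h2
  have hc1 : ContinuousAt (fun w => (m+1) * H w + w * deriv H w) (0:ℂ) := by
    have := hH.continuousAt
    have := hH.deriv.continuousAt
    fun_prop
  have hc2 : ContinuousAt (fun w => (m+1) * g w) (0:ℂ) := by
    have := hg.continuousAt
    fun_prop
  have t1 := hc1.tendsto.mono_left (nhdsWithin_le_nhds (s := {0}ᶜ))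
  have t2 := hc2.tendsto.mono_left (nhdsWithin_le_nhds (s := {0}ᶜ))
  have := tendsto_nhds_unique (t1.congr' hlim) t2
  simp only [hg0, zero_mul, add_zero] at this
  exact mul_left_cancel₀ hm this

lemma aux_local (m : ℕ) (g : ℂ → ℂ) (hg : AnalyticAt ℂ g 0) (hg0 : g 0 = 1) :
    ∃ h : ℂ → ℂ, AnalyticAt ℂ h 0 ∧ h 0 = 1 ∧
      ∀ᶠ w in nhds (0:ℂ), deriv (fun w => w * h w) w * (w * h w) ^ m = w ^ m * g w := by
  obtain ⟨H, hH, hH0, hder⟩ := aux_prim m g hg hg0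
  have hm : ((m:ℂ)+1) ≠ 0 := by exact_mod_cast Nat.succ_ne_zero m
  have hslit : H 0 ∈ Complex.slitPlane := by rw [hH0]; exact Complex.one_mem_slitPlane
  have hh : AnalyticAt ℂ (fun w => Complex.exp (Complex.log (H w) / (m+1))) 0 :=
    ((hH.clog hslit).div analyticAt_const hm).cexp
  refine ⟨fun w => Complex.exp (Complex.log (H w) / (m+1)), hh, by simp [hH0], ?_⟩
  have hne : ∀ᶠ w in nhds (0:ℂ), H w ≠ 0 :=
    hH.continuousAt.eventually_ne (by rw [hH0]; exact one_ne_zero)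
  have hpow : ∀ᶠ w in nhds (0:ℂ), (w * Complex.exp (Complex.log (H w) / (m+1))) ^ (m+1)
      = w ^ (m+1) * H w := by
    filter_upwards [hne] with w hw
    rw [mul_pow, ← Complex.exp_nat_mul]
    push_cast
    rw [mul_div_cancel₀ _ hm, Complex.exp_log hw]
  filter_upwards [hder, hh.eventually_analyticAt, hpow.eventually_nhds] with w h1 h2 h3
  have h4 : DifferentiableAt ℂ (fun w => w * Complex.exp (Complex.log (H w) / (m+1))) w :=
    differentiableAt_id.mul h2.differentiableAt
  have h5 := h4.hasDerivAt.pow (m+1)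
  have h6 := (h1.congr_of_eventuallyEq h3).unique h5
  push_cast at h6
  apply mul_left_cancel₀ hm
  linear_combination -h6

lemma aux_exists (m : ℕ) (P : Polynomial ℂ) (hmonic : P.Monic) (hdeg : P.natDegree = m + 2) :
    ∃ R : ℝ, 0 < R ∧ ∃ φ : ℂ → ℂ,
      DifferentiableOn ℂ φ {z : ℂ | R < ‖z‖} ∧
      Set.InjOn φ {z : ℂ | R < ‖z‖} ∧
      Tendsto (fun z : ℂ => φ z / z) (Bornology.cobounded ℂ) (nhds 1) ∧
      ∀ z : ℂ, R < ‖z‖ → deriv φ z * P.eval z = (φ z) ^ (m + 2) := by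
  have hQ0 : P.reverse.eval 0 = 1 := by
    rw [← Polynomial.coeff_zero_eq_eval_zero, Polynomial.coeff_zero_reverse]
    exact hmonic
  have hQan : AnalyticAt ℂ (fun w => P.reverse.eval w) 0 :=
    P.reverse.differentiable.analyticAt 0
  obtain ⟨h, hh, hh0, hode⟩ := aux_local m (fun w => (P.reverse.eval w)⁻¹)
    (hQan.inv (by rw [hQ0]; exact one_ne_zero)) (by simp [hQ0])
  have hψan : AnalyticAt ℂ (fun w => w * h w) 0 := analyticAt_id.mul hh
  have hψd : HasStrictDerivAt (fun w => w * h w) 1 0 := by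
    have := (hasStrictDerivAt_id (0:ℂ)).mul hh.hasStrictDerivAt
    have e : (1:ℂ) * h 0 + id 0 * deriv h 0 = 1 := by simp [hh0]
    rw [e] at this
    exact this
  obtain ⟨s, hs, hinj⟩ := aux_local_inj hψd one_ne_zero
  have hQne : ∀ᶠ w in nhds (0:ℂ), P.reverse.eval w ≠ 0 :=
    hQan.continuousAt.eventually_ne (by rw [hQ0]; exact one_ne_zero)
  have hhne : ∀ᶠ w in nhds (0:ℂ), h w ≠ 0 :=
    hh.continuousAt.eventually_ne (by rw [hh0]; exact one_ne_zero)
  have hev := tendsto_inv₀_cobounded (α := ℂ) |>.eventually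
    (hode.and (hQne.and (hhne.and (hψan.eventually_analyticAt.and hs))))
  obtain ⟨R, hR, hall⟩ := aux_cob hev
  have hderiv : ∀ z : ℂ, R < ‖z‖ → HasDerivAt (fun z => (z⁻¹ * h z⁻¹)⁻¹)
      (-(deriv (fun w => w * h w) z⁻¹ * (-(z^2)⁻¹)) / (z⁻¹ * h z⁻¹)^2) z := by
    intro z hz
    have hz0 : z ≠ 0 := norm_pos_iff.1 (hR.trans hz)
    obtain ⟨-, -, a3, a4, -⟩ := hall z hz
    have b1 : HasDerivAt (fun z : ℂ => z⁻¹ * h z⁻¹)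
        (deriv (fun w => w * h w) z⁻¹ * (-(z^2)⁻¹)) z :=
      HasDerivAt.comp (h₂ := fun w => w * h w) z a4.differentiableAt.hasDerivAt (hasDerivAt_inv hz0)
    exact b1.inv (mul_ne_zero (inv_ne_zero hz0) a3)
  refine ⟨R, hR, fun z => (z⁻¹ * h z⁻¹)⁻¹, ?_, ?_, ?_, ?_⟩
  · intro z hz
    exact (hderiv z hz).differentiableAt.differentiableWithinAt
  · intro x hx y hy hxy
    have := hinj (hall x hx).2.2.2.2 (hall y hy).2.2.2.2 (inv_injective hxy)
    exact inv_injective this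
  · have t : Tendsto (fun z : ℂ => (h z⁻¹)⁻¹) (Bornology.cobounded ℂ) (nhds 1) := by
      have := (hh.continuousAt.tendsto.comp (tendsto_inv₀_cobounded (α := ℂ))).inv₀
        (by rw [hh0]; exact one_ne_zero)
      simpa [hh0] using this
    refine t.congr' ?_
    filter_upwards [aux_cob' 0] with z hz
    have hz0 : z ≠ 0 := norm_pos_iff.1 hz
    rw [mul_inv, inv_inv]; field_simp
  · intro z hz
    have hz0 : z ≠ 0 := norm_pos_iff.1 (hR.trans hz)
    obtain ⟨a1, a2, a3, -, -⟩ := hall z hz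
    rw [(hderiv z hz).deriv]
    let _ := invertibleOfNonzero hz0
    have hP := Polynomial.eval₂_reverse_mul_pow (RingHom.id ℂ) z P
    rw [hdeg, invOf_eq_inv] at hP
    change P.reverse.eval z⁻¹ * z ^ (m+2) = P.eval z at hP
    rw [← hP]
    beta_reduce
    have hw : z⁻¹ ≠ 0 := inv_ne_zero hz0
    generalize deriv (fun w => w * h w) z⁻¹ = D at *
    generalize P.reverse.eval z⁻¹ = Q at *
    generalize h z⁻¹ = k at *
    have a1' : D * k ^ m * Q = 1 := by
      have hzm : (z⁻¹) ^ m ≠ 0 := pow_ne_zero _ hw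
      apply mul_left_cancel₀ hzm
      calc _ = (D * (z⁻¹ * k) ^ m) * Q := by ring
        _ = _ := by rw [a1]; field_simp
    have hk : k ^ (m+2) ≠ 0 := pow_ne_zero _ a3
    apply mul_right_cancel₀ hk
    calc _ = (D * k ^ m * Q) * z ^ (m+2) := by field_simp; ring
      _ = _ := by
        rw [a1', inv_pow, mul_pow, inv_pow]; field_simp

lemma aux_tend_infty {φ : ℂ → ℂ}
    (h : Tendsto (fun z : ℂ => φ z / z) (Bornology.cobounded ℂ) (nhds 1)) :
    Tendsto (fun z : ℂ => (φ z)⁻¹) (Bornology.cobounded ℂ) (nhds 0) ∧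
      ∀ᶠ z in Bornology.cobounded ℂ, φ z ≠ 0 := by
  constructor
  · have := (h.inv₀ one_ne_zero).mul (tendsto_inv₀_cobounded (α := ℂ))
    simp only [mul_zero] at this
    refine this.congr' ?_
    filter_upwards [aux_cob' 0] with z hz
    have hz0 : z ≠ 0 := norm_pos_iff.1 hz
    rw [inv_div]; field_simp
  · filter_upwards [h.eventually_ne one_ne_zero] with z hz h0
    simp [h0] at hz

lemma aux_deriv (m : ℕ) {φ : ℂ → ℂ} {z p : ℂ} (hd : DifferentiableAt ℂ φ z) (h0 : φ z ≠ 0)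
    (h : deriv φ z * p = φ z ^ (m + 2)) :
    HasDerivAt (fun z => ((φ z)⁻¹) ^ (m+1)) (-(m+1) / p) z := by
  have hp : p ≠ 0 := by
    rintro rfl
    rw [mul_zero] at h
    exact pow_ne_zero _ h0 h.symm
  have h1 := (hd.hasDerivAt.inv h0).pow (m+1)
  refine h1.congr_deriv ?_
  have : deriv φ z = φ z ^ (m+2) / p := by rw [← h]; field_simp
  rw [this]
  push_cast
  simp only [Pi.inv_apply, inv_pow]
  field_simp
  ring

lemma aux_unique (m : ℕ) (P : Polynomial ℂ) (R₁ R₂ : ℝ) (φ₁ φ₂ : ℂ → ℂ) (hR₁ : 0 < R₁)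
    (hd₁ : DifferentiableOn ℂ φ₁ {z : ℂ | R₁ < ‖z‖})
    (ht₁ : Tendsto (fun z : ℂ => φ₁ z / z) (Bornology.cobounded ℂ) (nhds 1))
    (he₁ : ∀ z : ℂ, R₁ < ‖z‖ → deriv φ₁ z * P.eval z = (φ₁ z) ^ (m + 2))
    (hd₂ : DifferentiableOn ℂ φ₂ {z : ℂ | R₂ < ‖z‖})
    (ht₂ : Tendsto (fun z : ℂ => φ₂ z / z) (Bornology.cobounded ℂ) (nhds 1))
    (he₂ : ∀ z : ℂ, R₂ < ‖z‖ → deriv φ₂ z * P.eval z = (φ₂ z) ^ (m + 2)) :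
    ∀ z : ℂ, max R₁ R₂ < ‖z‖ → φ₁ z = φ₂ z := by
  obtain ⟨i₁, n₁⟩ := aux_tend_infty ht₁
  obtain ⟨i₂, n₂⟩ := aux_tend_infty ht₂
  obtain ⟨R, hR, hall⟩ := aux_cob ((aux_cob' (max R₁ R₂)).and (n₁.and n₂))
  have D₁ : ∀ z : ℂ, R < ‖z‖ → HasDerivAt (fun z => ((φ₁ z)⁻¹) ^ (m+1)) (-(m+1) / P.eval z) z := by
    intro z hz
    obtain ⟨a, b, c⟩ := hall z hz
    have hz1 : R₁ < ‖z‖ := (le_max_left _ _).trans_lt a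
    exact aux_deriv m (hd₁.differentiableAt ((aux_open R₁).mem_nhds hz1)) b (he₁ z hz1)
  have D₂ : ∀ z : ℂ, R < ‖z‖ → HasDerivAt (fun z => ((φ₂ z)⁻¹) ^ (m+1)) (-(m+1) / P.eval z) z := by
    intro z hz
    obtain ⟨a, b, c⟩ := hall z hz
    have hz1 : R₂ < ‖z‖ := (le_max_right _ _).trans_lt a
    exact aux_deriv m (hd₂.differentiableAt ((aux_open R₂).mem_nhds hz1)) c (he₂ z hz1)
  obtain ⟨a, ha⟩ := (aux_open R).exists_eq_add_of_deriv_eq (aux_preconn R hR)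
    (fun z hz => (D₁ z hz).differentiableAt.differentiableWithinAt)
    (fun z hz => (D₂ z hz).differentiableAt.differentiableWithinAt)
    (fun z hz => by rw [(D₁ z hz).deriv, (D₂ z hz).deriv])
  have haev : ∀ᶠ z in Bornology.cobounded ℂ,
      ((φ₁ z)⁻¹) ^ (m+1) - ((φ₂ z)⁻¹) ^ (m+1) = a := by
    filter_upwards [aux_cob' R] with z hz
    have : ((φ₁ z)⁻¹) ^ (m+1) = ((φ₂ z)⁻¹) ^ (m+1) + a := ha hz
    rw [this]; ring
  have ha0 : a = 0 := by
    have t := ((i₁.pow (m+1)).sub (i₂.pow (m+1))).congr' haev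
    have := tendsto_nhds_unique t tendsto_const_nhds
    simpa using this.symm
  have hu : Tendsto (fun z => φ₁ z / φ₂ z) (Bornology.cobounded ℂ) (nhds 1) := by
    have := ht₁.div ht₂ one_ne_zero
    rw [div_one] at this
    refine this.congr' ?_
    filter_upwards [aux_cob' 0] with z hz
    have hz0 : z ≠ 0 := norm_pos_iff.1 hz
    exact div_div_div_cancel_right₀ hz0 _ _
  obtain ⟨s, hs, hinj⟩ := aux_local_inj (hasStrictDerivAt_pow (m+1) (1:ℂ))
    (by simpa using (by exact_mod_cast Nat.succ_ne_zero m : (m:ℂ) + 1 ≠ 0))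
  have heq : ∀ᶠ z in Bornology.cobounded ℂ, φ₁ z = φ₂ z := by
    filter_upwards [haev, hu hs, n₁, n₂] with z h1 h2 h3 h4
    have h5 : φ₁ z / φ₂ z = 1 := by
      refine hinj h2 (mem_of_mem_nhds hs) ?_
      rw [ha0, sub_eq_zero, inv_pow, inv_pow, inv_inj] at h1
      simp only [div_pow, one_pow, h1]
      exact div_self (pow_ne_zero _ h4)
    exact (div_eq_one_iff_eq h4).1 h5
  obtain ⟨R', hR', hall'⟩ := aux_cob (heq.and (aux_cob' (max R₁ R₂)))
  obtain ⟨z₀, hz₀⟩ := (aux_cob' R').exists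
  have hmax : 0 < max R₁ R₂ := lt_max_of_lt_left hR₁
  have hA₁ : AnalyticOnNhd ℂ φ₁ {z : ℂ | max R₁ R₂ < ‖z‖} :=
    (hd₁.mono fun z hz => (le_max_left R₁ R₂).trans_lt hz).analyticOnNhd (aux_open _)
  have hA₂ : AnalyticOnNhd ℂ φ₂ {z : ℂ | max R₁ R₂ < ‖z‖} :=
    (hd₂.mono fun z hz => (le_max_right R₁ R₂).trans_lt hz).analyticOnNhd (aux_open _)
  have hfin := hA₁.eqOn_of_preconnected_of_eventuallyEq hA₂ (aux_preconn _ hmax)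
    (hall' z₀ hz₀).2
    (Filter.eventually_of_mem ((aux_open R').mem_nhds hz₀) fun z hz => (hall' z hz).1)
  exact fun z hz => hfin hz

/-- For every monic centered polynomial `P` of degree `d ≥ 2` there
exist `R > 0` and a holomorphic injective map `φ` on `{|z| > R}`, tangent to the
identity at infinity (`φ(z)/z → 1` as `z → ∞`), conjugating the vector field
`ξ_P = P(z) d/dz` to `ξ₀ = z^d d/dz`, i.e. `φ'(z)·P(z) = φ(z)^d` on `{|z| > R}`.
Moreover `φ` is unique as a germ at infinity. -/
theorem exists_unique_rectification_at_infinity (d : ℕ) (hd : 2 ≤ d)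
    (P : Polynomial ℂ) (hmonic : P.Monic) (hdeg : P.natDegree = d)
    (hcent : P.coeff (d - 1) = 0) :
    (∃ R : ℝ, 0 < R ∧ ∃ φ : ℂ → ℂ,
      DifferentiableOn ℂ φ {z : ℂ | R < ‖z‖} ∧
      Set.InjOn φ {z : ℂ | R < ‖z‖} ∧
      Tendsto (fun z : ℂ => φ z / z) (Bornology.cobounded ℂ) (nhds 1) ∧
      ∀ z : ℂ, R < ‖z‖ → deriv φ z * P.eval z = (φ z) ^ d) ∧
    (∀ (R₁ R₂ : ℝ) (φ₁ φ₂ : ℂ → ℂ), 0 < R₁ → 0 < R₂ →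
      DifferentiableOn ℂ φ₁ {z : ℂ | R₁ < ‖z‖} →
      Set.InjOn φ₁ {z : ℂ | R₁ < ‖z‖} →
      Tendsto (fun z : ℂ => φ₁ z / z) (Bornology.cobounded ℂ) (nhds 1) →
      (∀ z : ℂ, R₁ < ‖z‖ → deriv φ₁ z * P.eval z = (φ₁ z) ^ d) →
      DifferentiableOn ℂ φ₂ {z : ℂ | R₂ < ‖z‖} →
      Set.InjOn φ₂ {z : ℂ | R₂ < ‖z‖} →
      Tendsto (fun z : ℂ => φ₂ z / z) (Bornology.cobounded ℂ) (nhds 1) →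
      (∀ z : ℂ, R₂ < ‖z‖ → deriv φ₂ z * P.eval z = (φ₂ z) ^ d) →
      ∀ z : ℂ, max R₁ R₂ < ‖z‖ → φ₁ z = φ₂ z) := by
  obtain ⟨m, rfl⟩ := Nat.exists_eq_add_of_le' hd
  refine ⟨aux_exists m P hmonic hdeg, ?_⟩
  intro R₁ R₂ φ₁ φ₂ hR₁ _ hd₁ _ ht₁ he₁ hd₂ _ ht₂ he₂
  exact aux_unique m P R₁ R₂ φ₁ φ₂ hR₁ hd₁ ht₁ he₁ hd₂ ht₂ he₂
end

section
/- Let f be holomorphic and injective on the open disk B(z₀, R) = {z ∈ ℂ : |z − z₀| < R}, where R > 0. Then for every z ∈ B(z₀, R): (|z − z₀|/R)/(1 + |z − z₀|/R)² ≤ |f(z) − f(z₀)|/(R·|f'(z₀)|) ≤ (|z − z₀|/R)/(1 − |z − z₀|/R)². -/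
open Set Filter Metric Topology

/-- An injective holomorphic function on an open ball has nonvanishing derivative at the center. -/
lemma kd_deriv_ne_zero {f : ℂ → ℂ} {c : ℂ} {R : ℝ} (hR : 0 < R)
    (hf : DifferentiableOn ℂ f (ball c R)) (hinj : InjOn f (ball c R)) : deriv f c ≠ 0 := by
  have hc : c ∈ ball c R := mem_ball_self hR
  have hfa : AnalyticOnNhd ℂ f (ball c R) := hf.analyticOnNhd isOpen_ball
  have hne : ∃ d ∈ ball c R, d ≠ c := by
    refine ⟨c + (R / 2 : ℝ), ?_, ?_⟩
    · simp [abs_of_pos hR]; linarith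
    · simp [hR.ne']
  obtain ⟨d, hd, hdc⟩ := hne
  have hopen : ∀ s ⊆ ball c R, IsOpen s → IsOpen (f '' s) := by
    rcases hfa.is_constant_or_isOpen (convex_ball c R).isPreconnected with ⟨w, hw⟩ | h
    · exact absurd (hinj hd hc ((hw d hd).trans (hw c hc).symm)) hdc
    · exact h
  set g := Function.invFunOn f (ball c R) with hg
  have hgl : LeftInvOn g f (ball c R) := hinj.leftInvOn_invFunOn
  have hcont : ∀ z ∈ ball c R, ContinuousAt g (f z) := by
    intro z hz
    rw [ContinuousAt, hgl hz]
    intro s hs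
    have h1 : s ∩ ball c R ∈ 𝓝 z := inter_mem hs (isOpen_ball.mem_nhds hz)
    obtain ⟨t, hts, hto, hzt⟩ := _root_.mem_nhds_iff.1 h1
    have h2 : f '' t ∈ 𝓝 (f z) :=
      (hopen t (fun x hx => (hts hx).2) hto).mem_nhds (mem_image_of_mem f hzt)
    rw [Filter.mem_map]
    refine mem_of_superset h2 ?_
    rintro _ ⟨x, hx, rfl⟩
    simp only [mem_preimage]
    rw [hgl (hts hx).2]
    exact (hts hx).1
  have hd' : AnalyticAt ℂ (deriv f) c := (hfa c hc).deriv
  rcases hd'.eventually_eq_zero_or_eventually_ne_zero with h0 | h0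
  · exfalso
    have hz : EqOn (deriv f) 0 (ball c R) :=
      hfa.deriv.eqOn_zero_of_preconnected_of_eventuallyEq_zero
        (convex_ball c R).isPreconnected hc h0
    have := (convex_ball c R).is_const_of_fderivWithin_eq_zero (𝕜 := ℂ) hf (fun x hx => by
      rw [fderivWithin_of_isOpen isOpen_ball hx]
      ext
      have := hz hx
      simpa using this) hd hc
    exact hdc (hinj hd hc this)
  · rw [eventually_nhdsWithin_iff] at h0
    have h1 : {z | z ∈ ({c}ᶜ : Set ℂ) → deriv f z ≠ 0} ∩ ball c R ∈ 𝓝 c :=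
      inter_mem h0 (isOpen_ball.mem_nhds hc)
    obtain ⟨t, hts, hto, hct⟩ := _root_.mem_nhds_iff.1 h1
    have htb : t ⊆ ball c R := fun x hx => (hts hx).2
    have hV : f '' t ∈ 𝓝 (f c) := (hopen t htb hto).mem_nhds (mem_image_of_mem f hct)
    have hgd : DifferentiableOn ℂ g (f '' t) := by
      rw [← Complex.differentiableOn_compl_singleton_and_continuousAt_iff hV]
      refine ⟨?_, hcont c hc⟩
      rintro _ ⟨⟨x, hx, rfl⟩, hxc⟩
      have hxc' : x ≠ c := fun h => hxc (by simp [h])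
      have := HasDerivAt.of_local_left_inverse (f := f) (g := g) (f' := deriv f x) (a := f x)
        (hcont x (htb hx)) (by
          rw [hgl (htb hx)]
          exact (hf.differentiableAt (isOpen_ball.mem_nhds (htb hx))).hasDerivAt)
        ((hts hx).1 hxc') (by
          filter_upwards [(hopen t htb hto).mem_nhds (mem_image_of_mem f hx)]
          rintro _ ⟨y, hy, rfl⟩
          rw [hgl (htb hy)])
      exact this.differentiableAt.differentiableWithinAt
    have hgc := (hgd.differentiableAt hV).hasDerivAt
    have hfc := (hf.differentiableAt (isOpen_ball.mem_nhds hc)).hasDerivAt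
    have hcomp := hgc.comp c hfc
    have hid : HasDerivAt (g ∘ f) 1 c := by
      refine (hasDerivAt_id c).congr_of_eventuallyEq ?_
      filter_upwards [isOpen_ball.mem_nhds hc] with x hx
      simp [hgl hx]
    have := hcomp.unique hid
    intro h
    simp [h] at this

open MeasureTheory in
/-- Change of variables for the logarithmic area. -/
lemma kd_change {h h' : ℂ → ℂ} {A : Set ℂ} (hA : MeasurableSet A)
    (hd : ∀ z ∈ A, HasDerivAt h (h' z) z) (hinj : InjOn h A) :
    ∫⁻ w in h '' A, ENNReal.ofReal ((‖w‖ ^ 2)⁻¹)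
      = ∫⁻ z in A, ENNReal.ofReal (‖h' z / h z‖ ^ 2) := by
  have hdet : ∀ a : ℂ, (a • (1 : ℂ →L[ℝ] ℂ)).det = ‖a‖ ^ 2 := by
    intro a
    rw [Complex.sq_norm, ← Algebra.norm_complex_apply, Algebra.norm_apply]
    unfold ContinuousLinearMap.det
    congr 1
  rw [lintegral_image_eq_lintegral_abs_det_fderiv_mul volume hA
    (fun z hz => ((hd z hz).complexToReal_fderiv).hasFDerivWithinAt) hinj]
  refine lintegral_congr fun z => ?_
  rw [hdet, abs_of_nonneg (by positivity), ← ENNReal.ofReal_mul (by positivity), norm_div, div_pow,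
    div_eq_mul_inv]

open MeasureTheory in
/-- Polar coordinates on an annulus-like region. -/
lemma kd_polar {g : ℂ → ℝ} {S : Set ℝ} (hS : MeasurableSet S) (hS0 : S ⊆ Ioi 0)
    (hg : ContinuousOn g {z | ‖z‖ ∈ S}) :
    ∫⁻ z in {z : ℂ | ‖z‖ ∈ S}, ENNReal.ofReal (g z)
      = ∫⁻ s in S, ∫⁻ θ in Ioo (-Real.pi) Real.pi, ENNReal.ofReal (s * g (circleMap 0 s θ)) := by
  have hmS : MeasurableSet {z : ℂ | ‖z‖ ∈ S} := measurable_norm hS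
  rw [← lintegral_indicator hmS, ← Complex.lintegral_comp_polarCoord_symm]
  have e1 : ∀ p ∈ polarCoord.target, ENNReal.ofReal p.1 •
      ({z : ℂ | ‖z‖ ∈ S}.indicator (fun z => ENNReal.ofReal (g z))) (Complex.polarCoord.symm p)
      = (S ×ˢ Ioo (-Real.pi) Real.pi).indicator
        (fun p : ℝ × ℝ => ENNReal.ofReal (p.1 * g (circleMap 0 p.1 p.2))) p := by
    rintro ⟨s, θ⟩ ⟨hs, hθ⟩
    have hs' : 0 < s := hs
    have hc : Complex.polarCoord.symm (s, θ) = circleMap 0 s θ := by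
      rw [Complex.polarCoord_symm_apply, circleMap, Complex.exp_mul_I]; simp
    rw [hc]
    by_cases h : s ∈ S
    · rw [indicator_of_mem (by simpa [abs_of_pos hs'] using h), indicator_of_mem (show (s, θ) ∈ S ×ˢ Ioo (-Real.pi) Real.pi from ⟨h, hθ⟩),
        smul_eq_mul, ← ENNReal.ofReal_mul hs'.le]
    · rw [indicator_of_notMem (by simpa [abs_of_pos hs'] using h),
        indicator_of_notMem (fun h' => h h'.1), smul_zero]
  have hmT : MeasurableSet polarCoord.target := polarCoord.open_target.measurableSet
  rw [setLIntegral_congr_fun hmT e1]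
  have hmP : MeasurableSet (S ×ˢ Ioo (-Real.pi) Real.pi) := hS.prod measurableSet_Ioo
  rw [setLIntegral_indicator hmP]
  have e2 : S ×ˢ Ioo (-Real.pi) Real.pi ∩ polarCoord.target = S ×ˢ Ioo (-Real.pi) Real.pi := by
    apply inter_eq_left.2
    rintro ⟨s, θ⟩ ⟨hs, hθ⟩
    exact ⟨hS0 hs, hθ⟩
  rw [e2, Measure.volume_eq_prod, setLIntegral_prod]
  rw [← Measure.volume_eq_prod]
  apply AEMeasurable.ennreal_ofReal
  apply ContinuousOn.aemeasurable _ hmP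
  apply continuousOn_fst.mul
  refine hg.comp (t := {z : ℂ | ‖z‖ ∈ S}) (f := fun p : ℝ × ℝ => circleMap 0 p.1 p.2) ?_ ?_
  · unfold circleMap
    fun_prop
  · rintro ⟨s, θ⟩ ⟨hs, hθ⟩
    have : 0 < s := hS0 hs
    simpa [abs_of_pos this] using hs

open MeasureTheory in
/-- Upper bound for the total logarithmic area of an annulus. -/
lemma kd_annulus {m : ℝ} (hm : 0 < m) (hm1 : m ≤ 1) :
    ∫⁻ z in {z : ℂ | ‖z‖ ∈ Icc m m⁻¹}, ENNReal.ofReal ((‖z‖ ^ 2)⁻¹)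
      = ENNReal.ofReal (4 * Real.pi * Real.log m⁻¹) := by
  have hpi := Real.pi_pos
  have hS0 : Icc m m⁻¹ ⊆ Ioi 0 := fun s hs => hm.trans_le hs.1
  have hmm : m ≤ m⁻¹ := hm1.trans ((one_le_inv₀ hm).2 hm1)
  rw [kd_polar measurableSet_Icc hS0]
  · have e : ∀ s ∈ Icc m m⁻¹, ∫⁻ θ in Ioo (-Real.pi) Real.pi,
        ENNReal.ofReal (s * (‖circleMap 0 s θ‖ ^ 2)⁻¹)
        = ENNReal.ofReal (2 * Real.pi * s⁻¹) := by
      intro s hs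
      have hs0 : 0 < s := hS0 hs
      simp only [norm_circleMap_zero, sq_abs]
      rw [setLIntegral_const, Real.volume_Ioo, ← ENNReal.ofReal_mul (by positivity)]
      congr 1
      field_simp
      ring
    rw [setLIntegral_congr_fun measurableSet_Icc e]
    have hci : ContinuousOn (fun s : ℝ => 2 * Real.pi * s⁻¹) (Icc m m⁻¹) :=
      continuousOn_const.mul (continuousOn_inv₀.mono fun s hs => ne_of_gt (hS0 hs))
    rw [← ofReal_integral_eq_lintegral_ofReal hci.integrableOn_Icc]
    · congr 1
      rw [integral_Icc_eq_integral_Ioc, ← intervalIntegral.integral_of_le hmm,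
        intervalIntegral.integral_const_mul, integral_inv_of_pos hm (by positivity)]
      rw [Real.log_div (by positivity) (by positivity), Real.log_inv]
      ring
    · filter_upwards [ae_restrict_mem measurableSet_Icc] with s hs
      have hs0 : 0 < s := hS0 hs
      simp only [Pi.zero_apply]; positivity
  · refine ContinuousOn.inv₀ (by fun_prop) ?_
    intro z hz
    have : 0 < ‖z‖ := hS0 hz
    positivity

open MeasureTheory in
/-- Lower bound for the logarithmic area. -/
lemma kd_lower_area {k : ℂ → ℂ} (hk : DifferentiableOn ℂ k (ball 0 1)) (hk0 : k 0 = 1)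
    {ρ : ℝ} (hρ : 0 < ρ) (hρ1 : ρ < 1) :
    ENNReal.ofReal (2 * Real.pi * Real.log ρ⁻¹)
      ≤ ∫⁻ z in {z : ℂ | ‖z‖ ∈ Ioo ρ 1}, ENNReal.ofReal (‖k z / z‖ ^ 2) := by
  have hpi := Real.pi_pos
  have hS0 : Ioo ρ 1 ⊆ Ioi 0 := fun s hs => hρ.trans hs.1
  rw [kd_polar measurableSet_Ioo hS0]
  · have e : ∀ s ∈ Ioo ρ 1, ENNReal.ofReal (2 * Real.pi * s⁻¹) ≤ ∫⁻ θ in Ioo (-Real.pi) Real.pi,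
        ENNReal.ofReal (s * ‖k (circleMap 0 s θ) / circleMap 0 s θ‖ ^ 2) := by
      intro s hs
      have hs0 : 0 < s := hS0 hs
      have hkc : Continuous fun θ => k (circleMap 0 s θ) := by
        refine hk.continuousOn.comp_continuous (continuous_circleMap 0 s) ?_
        intro θ
        simpa [abs_of_pos hs0] using hs.2
      have hmean : ∫ θ in (-Real.pi)..Real.pi, k (circleMap 0 s θ) = 2 * Real.pi := by
        have h1 : DiffContOnCl ℂ k (ball 0 |s|) := by
          rw [abs_of_pos hs0]
          exact hk.diffContOnCl_ball (closedBall_subset_ball hs.2)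
        have h2 := h1.circleAverage
        rw [Real.circleAverage_def, hk0] at h2
        have hper : Function.Periodic (fun θ => k (circleMap 0 s θ)) (2 * Real.pi) :=
          (periodic_circleMap 0 s).comp k
        have h3 := hper.intervalIntegral_add_eq (-Real.pi) 0
        rw [show -Real.pi + 2 * Real.pi = Real.pi by ring, zero_add] at h3
        rw [h3]
        have h4 : (2 * Real.pi : ℝ) ≠ 0 := by positivity
        rw [inv_smul_eq_iff₀ h4] at h2
        rw [h2]; simp
      have hre : ∫ θ in (-Real.pi)..Real.pi, (k (circleMap 0 s θ)).re = 2 * Real.pi := by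
        have := Complex.reCLM.intervalIntegral_comp_comm
          (hkc.intervalIntegrable (μ := volume) (-Real.pi) Real.pi)
        simp only [Complex.reCLM_apply] at this
        rw [this, hmean]; simp
      have hcn : Continuous fun θ => s⁻¹ * ‖k (circleMap 0 s θ)‖ ^ 2 :=
        continuous_const.mul (hkc.norm.pow 2)
      have e3 : ∀ θ, s * ‖k (circleMap 0 s θ) / circleMap 0 s θ‖ ^ 2
          = s⁻¹ * ‖k (circleMap 0 s θ)‖ ^ 2 := by
        intro θ
        rw [norm_div, norm_circleMap_zero, abs_of_pos hs0]
        field_simp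
      simp only [e3]
      rw [← ofReal_integral_eq_lintegral_ofReal
        ((hcn.integrableOn_Icc (a := -Real.pi) (b := Real.pi)).mono_set Ioo_subset_Icc_self)
        (Eventually.of_forall fun θ => by simp only [Pi.zero_apply]; positivity)]
      apply ENNReal.ofReal_le_ofReal
      rw [← integral_Ioc_eq_integral_Ioo, ← intervalIntegral.integral_of_le (by linarith),
        intervalIntegral.integral_const_mul]
      have hcr : Continuous fun θ => (k (circleMap 0 s θ)).re :=
        Complex.continuous_re.comp hkc
      have h5 : ∫ θ in (-Real.pi)..Real.pi, (2 * (k (circleMap 0 s θ)).re - 1) = 2 * Real.pi := by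
        rw [intervalIntegral.integral_sub ((hcr.const_mul 2).intervalIntegrable _ _) (by simp),
          intervalIntegral.integral_const_mul, hre]
        simp; ring
      have h6 : 2 * Real.pi ≤ ∫ θ in (-Real.pi)..Real.pi, ‖k (circleMap 0 s θ)‖ ^ 2 := by
        rw [← h5]
        apply intervalIntegral.integral_mono_on (by linarith)
        · exact Continuous.intervalIntegrable (by fun_prop) _ _
        · exact (hkc.norm.pow 2).intervalIntegrable _ _
        · intro θ _
          rw [Complex.sq_norm, Complex.normSq_apply]
          nlinarith [sq_nonneg ((k (circleMap 0 s θ)).re - 1), sq_nonneg (k (circleMap 0 s θ)).im]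
      rw [mul_comm]
      gcongr
    refine le_trans (le_of_eq ?_) (setLIntegral_mono' measurableSet_Ioo e)
    have hci : ContinuousOn (fun s : ℝ => 2 * Real.pi * s⁻¹) (Icc ρ 1) :=
      continuousOn_const.mul (continuousOn_inv₀.mono fun s hs => ne_of_gt (hρ.trans_le hs.1))
    rw [← ofReal_integral_eq_lintegral_ofReal (hci.integrableOn_Icc.mono_set Ioo_subset_Icc_self)]
    · congr 1
      rw [← integral_Ioc_eq_integral_Ioo, ← intervalIntegral.integral_of_le hρ1.le,
        intervalIntegral.integral_const_mul, integral_inv_of_pos hρ (by positivity)]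
      simp
    · filter_upwards [ae_restrict_mem measurableSet_Ioo] with s hs
      have hs0 : 0 < s := hS0 hs
      simp only [Pi.zero_apply]; positivity
  · refine ContinuousOn.pow (ContinuousOn.norm (ContinuousOn.div ?_ continuousOn_id ?_)) 2
    · refine hk.continuousOn.mono ?_
      intro z hz
      simpa using hz.2
    · intro z hz
      have : 0 < ‖z‖ := hS0 hz
      exact norm_pos_iff.1 this

/-- Quantitative covering of a disk. -/
lemma kd_cover {b : ℂ → ℂ} (hb : DifferentiableOn ℂ b (ball 0 1)) (h0 : b 0 = 0)
    {ρ m : ℝ} (hρ : 0 < ρ) (hρ1 : ρ < 1) (hm : ∀ z : ℂ, ‖z‖ = ρ → m ≤ ‖b z‖)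
    {w : ℂ} (hw : ‖w‖ < m) : ∃ z ∈ ball (0:ℂ) ρ, b z = w := by
  by_contra! hno
  have hcl : ∀ z ∈ closedBall (0:ℂ) ρ, b z - w ≠ 0 := by
    intro z hz h
    have h1 : b z = w := sub_eq_zero.1 h
    rcases (mem_closedBall_zero_iff.1 hz).lt_or_eq with h2 | h2
    · exact hno z (by simpa using h2) h1
    · have := hm z h2
      rw [h1] at this; linarith
  have hsub : closedBall (0:ℂ) ρ ⊆ ball 0 1 := closedBall_subset_ball hρ1
  have hd : DiffContOnCl ℂ (fun z => Complex.exp (-(b z / (b z - w)))) (ball 0 ρ) := by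
    apply DifferentiableOn.diffContOnCl
    rw [closure_ball _ hρ.ne']
    have hb' := hb.mono hsub
    exact ((hb'.div (hb'.sub_const w) hcl).neg).cexp
  have key := Complex.norm_le_of_forall_mem_frontier_norm_le isBounded_ball hd
    (C := Real.exp (-(1/2))) (by
      intro z hz
      rw [frontier_ball _ hρ.ne', mem_sphere_zero_iff_norm] at hz
      rw [Complex.norm_exp]
      apply Real.exp_le_exp.2
      have h1 : ‖w‖ < ‖b z‖ := hw.trans_le (hm z hz)
      have h2 := hcl z (by simp [hz])
      have h3 : 0 < Complex.normSq (b z - w) := Complex.normSq_pos.2 h2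
      rw [Complex.neg_re, neg_le_neg_iff, Complex.div_re, ← add_div, le_div_iff₀ h3]
      have h4 : ‖w‖ ^ 2 < ‖b z‖ ^ 2 := by gcongr
      rw [Complex.sq_norm, Complex.sq_norm, Complex.normSq_apply, Complex.normSq_apply] at h4
      rw [Complex.normSq_apply]
      simp
      nlinarith) (z := 0) (subset_closure (by simpa using hρ))
  simp [h0] at key
  linarith

open MeasureTheory in
/-- Area inequality: comparison of radii. -/
lemma kd_radius {b : ℂ → ℂ} (hb : DifferentiableOn ℂ b (ball 0 1)) (hinj : InjOn b (ball 0 1))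
    (h0 : b 0 = 0) (hprod : ∀ z ∈ ball (0:ℂ) 1, ∀ w ∈ ball (0:ℂ) 1, b z * b w ≠ 1)
    (hd0 : deriv b 0 ≠ 0) {ρ m : ℝ} (hρ : 0 < ρ) (hρ1 : ρ < 1) (hm0 : 0 < m)
    (hm : ∀ z : ℂ, ‖z‖ = ρ → m ≤ ‖b z‖) : m ≤ ρ := by
  have hpi := Real.pi_pos
  have h0m : (0:ℂ) ∈ ball (0:ℂ) 1 := by simp
  have hm1 : m ≤ 1 := by
    by_contra! h
    obtain ⟨z, hz, hz1⟩ := kd_cover hb h0 hρ hρ1 hm (w := 1) (by simpa using h)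
    have hz' : z ∈ ball (0:ℂ) 1 := ball_subset_ball hρ1.le hz
    exact hprod z hz' z hz' (by simp [hz1])
  have hbne : ∀ z ∈ ball (0:ℂ) 1, z ≠ 0 → b z ≠ 0 := by
    intro z hz hz0 h
    exact hz0 (hinj hz h0m (h.trans h0.symm))
  set d := dslope b 0 with hd
  have hdd : DifferentiableOn ℂ d (ball 0 1) :=
    (Complex.differentiableOn_dslope (isOpen_ball.mem_nhds h0m)).2 hb
  have hdz : ∀ z, z ≠ 0 → d z = b z / z := by
    intro z hz
    rw [hd, dslope_of_ne _ hz, slope_def_field, h0]; simp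
  have hdne : ∀ z ∈ ball (0:ℂ) 1, d z ≠ 0 := by
    intro z hz
    rcases eq_or_ne z 0 with rfl | hz0
    · rw [hd, dslope_same]; exact hd0
    · rw [hdz z hz0]; exact div_ne_zero (hbne z hz hz0) hz0
  set k : ℂ → ℂ := fun z => deriv b z / d z with hk
  have hkd : DifferentiableOn ℂ k (ball 0 1) :=
    (hb.deriv isOpen_ball).div hdd hdne
  have hk0 : k 0 = 1 := by
    simp only [hk, hd, dslope_same]; exact div_self hd0
  set A : Set ℂ := {z | ‖z‖ ∈ Ioo ρ 1} with hA
  have hAm : MeasurableSet A := measurable_norm measurableSet_Ioo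
  have hAb : A ⊆ ball 0 1 := fun z hz => by simpa using hz.2
  have hA0 : ∀ z ∈ A, z ≠ 0 := fun z hz => norm_pos_iff.1 (hρ.trans hz.1)
  have hbd : ∀ z ∈ A, HasDerivAt b (deriv b z) z := fun z hz =>
    (hb.differentiableAt (isOpen_ball.mem_nhds (hAb hz))).hasDerivAt
  have c1 := kd_change hAm hbd (hinj.mono hAb)
  have hbn : ∀ z ∈ A, b z ≠ 0 := fun z hz => hbne z (hAb hz) (hA0 z hz)
  have c2 := kd_change (h := fun z => (b z)⁻¹) hAm (fun z hz => (hbd z hz).inv (hbn z hz))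
    (fun z hz w hw h => hinj (hAb hz) (hAb hw) (inv_injective h))
  have low := kd_lower_area hkd hk0 hρ hρ1
  have i1 : ∫⁻ z in A, ENNReal.ofReal (‖k z / z‖ ^ 2)
      = ∫⁻ z in A, ENNReal.ofReal (‖deriv b z / b z‖ ^ 2) := by
    apply setLIntegral_congr_fun hAm
    intro z hz
    have h1 := hA0 z hz
    have h2 := hbn z hz
    have : k z / z = deriv b z / b z := by
      simp only [hk]; rw [hdz z h1]; field_simp
    simp only [this]
  have i2 : ∫⁻ z in A, ENNReal.ofReal (‖(-deriv b z / b z ^ 2) / (b z)⁻¹‖ ^ 2)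
      = ∫⁻ z in A, ENNReal.ofReal (‖deriv b z / b z‖ ^ 2) := by
    apply setLIntegral_congr_fun hAm
    intro z hz
    have h2 := hbn z hz
    have : (-deriv b z / b z ^ 2) / (b z)⁻¹ = -(deriv b z / b z) := by
      field_simp
    simp only [this, norm_neg]
  rw [i2, ← i1] at c2
  rw [← i1] at c1
  have hdisj : Disjoint (b '' A) ((fun z => (b z)⁻¹) '' A) := by
    rw [Set.disjoint_left]
    rintro _ ⟨z, hz, rfl⟩ ⟨w, hw, h⟩
    apply hprod z (hAb hz) w (hAb hw)
    simp only at h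
    rw [← h, inv_mul_cancel₀ (hbn w hw)]
  have hge : ∀ z ∈ A, m ≤ ‖b z‖ := by
    intro z hz
    by_contra! h
    obtain ⟨y, hy, hyz⟩ := kd_cover hb h0 hρ hρ1 hm h
    have := hinj (ball_subset_ball hρ1.le hy) (hAb hz) hyz
    rw [this, mem_ball_zero_iff] at hy
    linarith [hz.1]
  have hle : ∀ z ∈ A, ‖b z‖ ≤ m⁻¹ := by
    intro z hz
    by_contra! h
    obtain ⟨y, hy, hyz⟩ := kd_cover hb h0 hρ hρ1 hm (w := (b z)⁻¹) (by
      rw [norm_inv]; exact inv_lt_of_inv_lt₀ hm0 h)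
    apply hprod y (ball_subset_ball hρ1.le hy) z (hAb hz)
    rw [hyz, inv_mul_cancel₀ (hbn z hz)]
  have hsub : b '' A ∪ (fun z => (b z)⁻¹) '' A ⊆ {z : ℂ | ‖z‖ ∈ Icc m m⁻¹} := by
    rintro _ (⟨z, hz, rfl⟩ | ⟨z, hz, rfl⟩)
    · exact ⟨hge z hz, hle z hz⟩
    · simp only [mem_ofPred_eq, norm_inv, mem_Icc]
      exact ⟨le_inv_of_le_inv₀ (norm_pos_iff.2 (hbn z hz)) (hle z hz), inv_anti₀ hm0 (hge z hz)⟩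
  have hmeas : MeasurableSet ((fun z => (b z)⁻¹) '' A) :=
    measurable_image_of_fderivWithin hAm
      (fun z hz => (((hbd z hz).inv (hbn z hz)).complexToReal_fderiv).hasFDerivWithinAt)
      (fun z hz w hw h => hinj (hAb hz) (hAb hw) (inv_injective h))
  have hfin := lintegral_mono_set (μ := volume) (f := fun w : ℂ => ENNReal.ofReal ((‖w‖ ^ 2)⁻¹)) hsub
  rw [lintegral_union hmeas hdisj, kd_annulus hm0 hm1, c1] at hfin
  have c2' : ∫⁻ w in (fun z => (b z)⁻¹) '' A, ENNReal.ofReal ((‖w‖ ^ 2)⁻¹)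
     = ∫⁻ z in A, ENNReal.ofReal (‖k z / z‖ ^ 2) := c2
  rw [c2'] at hfin
  have h1 := (add_le_add low low).trans hfin
  have hlρ : 0 ≤ Real.log ρ⁻¹ := Real.log_nonneg ((one_le_inv₀ hρ).2 hρ1.le)
  have hlm : 0 ≤ Real.log m⁻¹ := Real.log_nonneg ((one_le_inv₀ hm0).2 hm1)
  rw [← ENNReal.ofReal_add (by positivity) (by positivity),
    ENNReal.ofReal_le_ofReal_iff (by positivity)] at h1
  have h2 : Real.log ρ⁻¹ ≤ Real.log m⁻¹ := by
    have : 4 * Real.pi * Real.log ρ⁻¹ ≤ 4 * Real.pi * Real.log m⁻¹ := by linarith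
    exact le_of_mul_le_mul_left this (by positivity)
  have h3 := (Real.log_le_log_iff (by positivity) (by positivity)).1 h2
  exact (inv_le_inv₀ hρ hm0).1 h3

/-- Area-type estimate for univalent Bieberbach-Eilenberg functions. -/
lemma kd_area {b : ℂ → ℂ} (hb : DifferentiableOn ℂ b (ball 0 1)) (hinj : InjOn b (ball 0 1))
    (h0 : b 0 = 0) (hprod : ∀ z ∈ ball (0:ℂ) 1, ∀ w ∈ ball (0:ℂ) 1, b z * b w ≠ 1) :
    ‖deriv b 0‖ ≤ 1 := by
  by_contra! hgt
  have hd0 : deriv b 0 ≠ 0 := norm_pos_iff.1 (by linarith)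
  have h0m : (0:ℂ) ∈ ball (0:ℂ) 1 := by simp
  have hder := (hb.differentiableAt (isOpen_ball.mem_nhds h0m)).hasDerivAt
  obtain ⟨c, hc1, hc2⟩ := exists_between hgt
  rw [hasDerivAt_iff_tendsto_slope] at hder
  have hev := hder.norm.eventually_const_lt hc2
  rw [eventually_nhdsWithin_iff, Metric.eventually_nhds_iff] at hev
  obtain ⟨ε, hε, hball⟩ := hev
  set ρ : ℝ := min ε 1 / 2 with hρdef
  have hmin : 0 < min ε 1 := lt_min hε one_pos
  have hρ : 0 < ρ := by positivity
  have hρε : ρ < ε := by have := min_le_left ε 1; linarith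
  have hρ1 : ρ < 1 := by have := min_le_right ε 1; linarith
  have := kd_radius hb hinj h0 hprod hd0 hρ hρ1 (m := c * ρ) (by positivity) (by
    intro z hz
    have hz0 : z ≠ 0 := norm_pos_iff.1 (by linarith)
    have h1 := hball (y := z) (by simpa [hz] using hρε) hz0
    rw [slope_def_field, h0, sub_zero, sub_zero, norm_div, hz, lt_div_iff₀ hρ] at h1
    exact h1.le)
  nlinarith

/-- Koebe quarter theorem. -/
lemma kd_quarter {p : ℂ → ℂ} (hp : DifferentiableOn ℂ p (ball 0 1)) (hinj : InjOn p (ball 0 1))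
    (hp0 : ∀ z ∈ ball (0:ℂ) 1, p z ≠ 0) : ‖deriv p 0‖ ≤ 4 * ‖p 0‖ := by
  have h0 : (0:ℂ) ∈ ball (0:ℂ) 1 := by simp
  have hsc : IsSimplyConnected (ball (0:ℂ) 1) := by
    have := (convex_ball (0:ℂ) 1).contractibleSpace ⟨0, by simp⟩
    show SimplyConnectedSpace _
    infer_instance
  obtain ⟨q, hqc, hq⟩ := Complex.exists_continuousOn_pow_eq hsc isOpen_ball hp.continuousOn
    (by rintro ⟨z, hz, h⟩; exact hp0 z hz h) two_ne_zero
  have hq0 : ∀ z ∈ ball (0:ℂ) 1, q z ≠ 0 := fun z hz h => hp0 z hz (by rw [← hq, h]; simp)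
  have hneg : ∀ z ∈ ball (0:ℂ) 1, ∀ w ∈ ball (0:ℂ) 1, q z + q w ≠ 0 := by
    intro z hz w hw h
    have h1 : q z = - q w := by linear_combination h
    have : z = w := hinj hz hw (by rw [← hq z, ← hq w, h1]; ring)
    subst this
    exact hq0 z hz (by linear_combination h / 2)
  have hqd : ∀ z ∈ ball (0:ℂ) 1, HasDerivAt q (deriv p z / (2 * q z)) z := by
    intro z hz
    have hpz := (hp.differentiableAt (isOpen_ball.mem_nhds hz)).hasDerivAt
    have hqz := hqc.continuousAt (isOpen_ball.mem_nhds hz)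
    rw [hasDerivAt_iff_tendsto_slope] at hpz ⊢
    have hsum : Tendsto (fun w => q w + q z) (𝓝[≠] z) (𝓝 (2 * q z)) := by
      have : Tendsto (fun w => q w + q z) (𝓝 z) (𝓝 (q z + q z)) := hqz.tendsto.add_const _
      rw [← two_mul] at this
      exact this.mono_left nhdsWithin_le_nhds
    refine (hpz.div hsum (by simpa using hq0 z hz)).congr' ?_
    have hmem : ∀ᶠ w in 𝓝[≠] z, w ∈ ball (0:ℂ) 1 :=
      nhdsWithin_le_nhds (isOpen_ball.mem_nhds hz)
    filter_upwards [hmem] with w hw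
    simp only [slope_def_field, Pi.div_apply]
    rw [← hq w, ← hq z]
    have := hneg w hw z hz
    field_simp
    ring
  have hs : ∀ z ∈ ball (0:ℂ) 1, q z + q 0 ≠ 0 := fun z hz => hneg z hz 0 h0
  set b : ℂ → ℂ := fun z => (q z - q 0) / (q z + q 0) with hbdef
  have hq00 := hq0 0 h0
  have hbd : ∀ z ∈ ball (0:ℂ) 1, HasDerivAt b
      ((deriv p z / (2 * q z) * (q z + q 0) - (q z - q 0) * (deriv p z / (2 * q z)))
        / (q z + q 0) ^ 2) z := fun z hz =>
    ((hqd z hz).sub_const _).div ((hqd z hz).add_const _) (hs z hz)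
  have key := kd_area (b := b)
    (fun z hz => (hbd z hz).differentiableAt.differentiableWithinAt)
    (by
      intro z hz w hw h
      simp only [hbdef] at h
      rw [div_eq_div_iff (hs z hz) (hs w hw)] at h
      have h2 : q z = q w := by
        have : 2 * q 0 * (q z - q w) = 0 := by linear_combination h
        rcases mul_eq_zero.1 this with h | h
        · simp [hq00] at h
        · linear_combination h
      exact hinj hz hw (by rw [← hq z, ← hq w, h2]))
    (by simp [hbdef])
    (by
      intro z hz w hw h
      simp only [hbdef] at h
      rw [div_mul_div_comm, div_eq_one_iff_eq (mul_ne_zero (hs z hz) (hs w hw))] at h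
      have : 2 * q 0 * (q z + q w) = 0 := by linear_combination -h
      rcases mul_eq_zero.1 this with h | h
      · simp [hq00] at h
      · exact hneg z hz w hw h)
  rw [(hbd 0 h0).deriv] at key
  have e : (deriv p 0 / (2 * q 0) * (q 0 + q 0) - (q 0 - q 0) * (deriv p 0 / (2 * q 0)))
        / (q 0 + q 0) ^ 2 = deriv p 0 / (4 * p 0) := by
    rw [← hq 0]; field_simp; ring
  rw [e, norm_div, div_le_one (by simpa using hp0 0 h0)] at key
  simpa using key

/-- The Cayley transform has positive real part. -/
lemma kd_cayley_re {z : ℂ} (hz : ‖z‖ < 1) : 0 < ((1 + z) / (1 - z)).re := by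
  have h1 : (1 - z) ≠ 0 := by
    intro h
    have : z = 1 := by linear_combination -h
    rw [this] at hz; simp at hz
  have hn : 0 < Complex.normSq (1 - z) := Complex.normSq_pos.2 h1
  have hz2 : z.re ^ 2 + z.im ^ 2 < 1 := by
    have := Complex.sq_norm z
    rw [Complex.normSq_apply] at this
    nlinarith [norm_nonneg z]
  rw [Complex.div_re, ← add_div]
  apply div_pos _ hn
  simp
  nlinarith

/-- A map of the right half plane to the disk. -/
lemma kd_halfplane_norm {s : ℂ} (hs : 0 < s.re) : ‖(s - 1) / (s + 1)‖ < 1 := by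
  have h1 : s + 1 ≠ 0 := by
    intro h
    have := congrArg Complex.re h
    simp at this; linarith
  rw [norm_div, div_lt_one (norm_pos_iff.2 h1)]
  apply lt_of_pow_lt_pow_left₀ 2 (norm_nonneg _)
  rw [Complex.sq_norm, Complex.sq_norm, Complex.normSq_apply, Complex.normSq_apply]
  simp
  nlinarith

/-- Two points in the right half plane with the same square agree. -/
lemma kd_sq_inj {s t : ℂ} (hs : 0 < s.re) (ht : 0 < t.re) (h : s ^ 2 = t ^ 2) : s = t := by
  rcases sq_eq_sq_iff_eq_or_eq_neg.1 h with h | h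
  · exact h
  · rw [h] at hs; simp at hs; linarith

/-- The conformal map of the disk to the disk minus the slit `(-1, -r]`. -/
lemma kd_slit (r : ℝ) (hr : 0 < r) (hr1 : r < 1) :
    ∃ ψ : ℂ → ℂ, DifferentiableOn ℂ ψ (ball 0 1) ∧ InjOn ψ (ball 0 1) ∧
      MapsTo ψ (ball 0 1) (ball 0 1) ∧ ψ 0 = 0 ∧ deriv ψ 0 = ((4 * r / (1 + r) ^ 2 : ℝ) : ℂ) ∧
      ∀ z ∈ ball (0:ℂ) 1, ψ z ≠ -r := by
  set c : ℝ := 4 * r / (1 + r) ^ 2 with hc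
  have hc0 : 0 < c := by positivity
  have hc1 : 1 - c = ((1 - r) / (1 + r)) ^ 2 := by rw [hc]; field_simp; ring
  have hc1' : 0 < 1 - c := by
    rw [hc1]; have : 0 < 1 - r := by linarith
    positivity
  set t : ℂ → ℂ := fun z => (1 + z) / (1 - z) with ht
  have hz1 : ∀ z ∈ ball (0:ℂ) 1, 1 - z ≠ 0 := by
    intro z hz h
    have : z = 1 := by linear_combination -h
    simp [this] at hz
  have htre : ∀ z ∈ ball (0:ℂ) 1, 0 < (t z).re := fun z hz => kd_cayley_re (by simpa using hz)
  have htd : ∀ z ∈ ball (0:ℂ) 1, HasDerivAt t (2 / (1 - z) ^ 2) z := by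
    intro z hz
    have := ((hasDerivAt_id z).const_add 1).div ((hasDerivAt_id z).const_sub 1) (hz1 z hz)
    convert! this using 1
    simp; ring
  set y : ℂ → ℂ := fun z => c * (t z) ^ 2 + (1 - c) with hy
  have hyd : ∀ z ∈ ball (0:ℂ) 1, HasDerivAt y (c * (2 * t z * (2 / (1 - z) ^ 2))) z := by
    intro z hz
    have := (((htd z hz).pow 2).const_mul (c:ℂ)).add_const (1 - (c:ℂ))
    convert! this using 1
    simp
  have hys : ∀ z ∈ ball (0:ℂ) 1, y z ∈ Complex.slitPlane := by
    intro z hz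
    rw [Complex.mem_slitPlane_iff]
    by_contra! h
    obtain ⟨h1, h2⟩ := h
    have h3 := htre z hz
    simp [hy, pow_two] at h1 h2
    have h4 : (t z).im = 0 := by
      rcases h2 with h2 | h2
      · linarith
      · nlinarith
    rw [h4] at h1
    nlinarith [mul_pos hc0 (mul_pos h3 h3)]
  set s : ℂ → ℂ := fun z => (y z) ^ (1 / 2 : ℂ) with hs
  have hss : ∀ z, s z ^ 2 = y z := by
    intro z
    simp only [hs]
    rw [← Complex.cpow_nat_mul]
    norm_num
  have hsre : ∀ z ∈ ball (0:ℂ) 1, 0 < (s z).re := by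
    intro z hz
    have hsl := hys z hz
    simp only [hs]
    rw [Complex.cpow_def_of_ne_zero (Complex.slitPlane_ne_zero hsl), Complex.exp_re]
    apply mul_pos (Real.exp_pos _)
    apply Real.cos_pos_of_mem_Ioo
    have h1 := Complex.neg_pi_lt_arg (y z)
    have h2 := (Complex.arg_le_pi (y z)).lt_of_ne (Complex.mem_slitPlane_iff_arg.1 hsl).1
    have e : (Complex.log (y z) * (1 / 2)).im = Complex.arg (y z) / 2 := by
      rw [show (1 / 2 : ℂ) = ((1/2 : ℝ) : ℂ) by simp, Complex.im_mul_ofReal, Complex.log_im]; ring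
    rw [e]
    constructor <;> linarith
  have hsd : ∀ z ∈ ball (0:ℂ) 1, DifferentiableAt ℂ s z := fun z hz =>
    (hyd z hz).differentiableAt.cpow (differentiableAt_const _) (hys z hz)
  have hs1 : ∀ z ∈ ball (0:ℂ) 1, s z + 1 ≠ 0 := by
    intro z hz h
    have := congrArg Complex.re h
    have := hsre z hz
    simp at *; linarith
  have h0 : (0:ℂ) ∈ ball (0:ℂ) 1 := by simp
  have hs0 : s 0 = 1 := by simp [hs, hy, ht]
  have hsd0 : HasDerivAt s (2 * c) 0 := by
    have h1 := (hsd 0 h0).hasDerivAt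
    have h2 := (h1.pow 2)
    have h3 : HasDerivAt (s ^ 2) (c * (2 * t 0 * (2 / (1 - 0) ^ 2))) 0 := by
      have : s ^ 2 = y := by ext z; exact hss z
      rw [this]; exact hyd 0 h0
    have h4 := h2.unique h3
    simp [hs0, ht] at h4
    have : deriv s 0 = 2 * c := by linear_combination h4 / 2
    rwa [this] at h1
  refine ⟨fun z => (s z - 1) / (s z + 1), ?_, ?_, ?_, ?_, ?_, ?_⟩
  · intro z hz
    exact (((hsd z hz).sub_const _).div ((hsd z hz).add_const _) (hs1 z hz)).differentiableWithinAt
  · intro z hz w hw h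
    simp only at h
    rw [div_eq_div_iff (hs1 z hz) (hs1 w hw)] at h
    have h1 : s z = s w := by linear_combination h / 2
    have h2 : y z = y w := by rw [← hss, ← hss, h1]
    have h3 : t z = t w := by
      apply kd_sq_inj (htre z hz) (htre w hw)
      have : (c:ℂ) ≠ 0 := by exact_mod_cast hc0.ne'
      apply mul_left_cancel₀ this
      simp only [hy] at h2
      linear_combination h2
    simp only [ht] at h3
    rw [div_eq_div_iff (hz1 z hz) (hz1 w hw)] at h3
    linear_combination h3 / 2
  · intro z hz
    simpa using kd_halfplane_norm (hsre z hz)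
  · simp [hs0]
  · have := (hsd0.sub_const 1).div (hsd0.add_const 1) (hs1 0 h0)
    have h2 := this.deriv
    rw [hs0] at h2
    refine Eq.trans h2 ?_
    ring
  · intro z hz h
    simp only at h
    rw [div_eq_iff (hs1 z hz)] at h
    have hr1' : (1 + r : ℂ) ≠ 0 := by exact_mod_cast (by linarith : (1 + r : ℝ) ≠ 0)
    have h1 : s z = (1 - r) / (1 + r) := by
      rw [eq_div_iff hr1']; linear_combination h
    have h2 := hss z
    have h3 : (1 - c : ℂ) = ((1 - r) / (1 + r)) ^ 2 := by exact_mod_cast hc1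
    rw [h1, ← h3] at h2
    simp only [hy] at h2
    have h4 : (c : ℂ) * t z ^ 2 = 0 := by linear_combination -h2
    have h5 : t z = 0 := by simpa [hc0.ne'] using h4
    have h6 := htre z hz
    rw [h5] at h6
    simp at h6

/-- Lower bound in the growth theorem. -/
lemma kd_lower {f : ℂ → ℂ} (hf : DifferentiableOn ℂ f (ball 0 1)) (hinj : InjOn f (ball 0 1))
    {z : ℂ} (hz : z ∈ ball (0:ℂ) 1) :
    ‖deriv f 0‖ * (‖z‖ / (1 + ‖z‖) ^ 2) ≤ ‖f z - f 0‖ := by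
  rcases eq_or_ne z 0 with rfl | hz0
  · simp
  have h0 : (0:ℂ) ∈ ball (0:ℂ) 1 := by simp
  set r := ‖z‖ with hr
  have hr0 : 0 < r := norm_pos_iff.2 hz0
  have hr1 : r < 1 := by simpa using hz
  obtain ⟨ψ, hψd, hψi, hψm, hψ0, hψ', hψo⟩ := kd_slit r hr0 hr1
  have hrc : (r : ℂ) ≠ 0 := by exact_mod_cast hr0.ne'
  set u : ℂ := -(z / r) with hu
  have hun : ‖u‖ = 1 := by
    rw [hu, norm_neg, norm_div, ← hr, Complex.norm_real, Real.norm_of_nonneg hr0.le, div_self hr0.ne']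
  have hu0 : u ≠ 0 := by rw [← norm_pos_iff, hun]; norm_num
  have hum : ∀ w ∈ ball (0:ℂ) 1, u * w ∈ ball (0:ℂ) 1 := by
    intro w hw; simpa [hun] using hw
  have hfd : ∀ w ∈ ball (0:ℂ) 1, HasDerivAt (fun w => f (u * ψ w) - f z)
      (deriv f (u * ψ w) * (u * deriv ψ w)) w := by
    intro w hw
    have h1 := ((hψd.differentiableAt (isOpen_ball.mem_nhds hw)).hasDerivAt).const_mul u
    have h2 := (hf.differentiableAt (isOpen_ball.mem_nhds (hum _ (hψm hw)))).hasDerivAt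
    exact (HasDerivAt.comp w h2 h1).sub_const _
  have key := kd_quarter (p := fun w => f (u * ψ w) - f z)
    (fun w hw => (hfd w hw).differentiableAt.differentiableWithinAt)
    (by
      intro a ha b hb h
      have h1 : f (u * ψ a) = f (u * ψ b) := by simpa using h
      have h2 := hinj (hum _ (hψm ha)) (hum _ (hψm hb)) h1
      exact hψi ha hb (mul_left_cancel₀ hu0 h2))
    (by
      intro w hw h
      have h1 := hinj (hum _ (hψm hw)) hz (sub_eq_zero.1 h)
      apply hψo w hw
      apply mul_left_cancel₀ hu0
      rw [h1, hu]; field_simp)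
  rw [(hfd 0 h0).deriv] at key
  simp only [hψ0, hψ', mul_zero, norm_mul, hun, one_mul, Complex.norm_real] at key
  rw [Real.norm_of_nonneg (by positivity), norm_sub_rev] at key
  have e : ‖deriv f 0‖ * (4 * r / (1 + r) ^ 2) = 4 * (‖deriv f 0‖ * (r / (1 + r) ^ 2)) := by ring
  linarith

/-- Bound for the logarithmic derivative, from the Koebe transform. -/
lemma kd_logderiv {f : ℂ → ℂ} (hf : DifferentiableOn ℂ f (ball 0 1)) (hinj : InjOn f (ball 0 1))
    {z : ℂ} (hz : z ∈ ball (0:ℂ) 1) :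
    ‖deriv f z‖ * (‖z‖ * (1 - ‖z‖)) ≤ ‖f z - f 0‖ * (1 + ‖z‖) := by
  have h0 : (0:ℂ) ∈ ball (0:ℂ) 1 := by simp
  have hr1 : ‖z‖ < 1 := by simpa using hz
  set φ : ℂ → ℂ := fun w => (w + z) / (1 + (starRingEnd ℂ) z * w) with hφ
  have hden : ∀ w ∈ ball (0:ℂ) 1, 1 + (starRingEnd ℂ) z * w ≠ 0 := by
    intro w hw h
    have h1 : (starRingEnd ℂ) z * w = -1 := by linear_combination h
    have h2 := congrArg norm h1
    have hw1 : ‖w‖ < 1 := by simpa using hw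
    simp at h2
    nlinarith [norm_nonneg z, norm_nonneg w]
  have hzz : z * (starRingEnd ℂ) z = ((‖z‖ ^ 2 : ℝ) : ℂ) := by
    rw [Complex.mul_conj, Complex.sq_norm]
  have hφm : MapsTo φ (ball 0 1) (ball 0 1) := by
    intro w hw
    have hw1 : ‖w‖ < 1 := by simpa using hw
    simp only [mem_ball_zero_iff, hφ]
    rw [norm_div, div_lt_one (norm_pos_iff.2 (hden w hw))]
    apply lt_of_pow_lt_pow_left₀ 2 (norm_nonneg _)
    have hz2 : z.re ^ 2 + z.im ^ 2 < 1 := by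
      have := Complex.sq_norm z
      rw [Complex.normSq_apply] at this
      nlinarith [norm_nonneg z]
    have hw2 : w.re ^ 2 + w.im ^ 2 < 1 := by
      have := Complex.sq_norm w
      rw [Complex.normSq_apply] at this
      nlinarith [norm_nonneg w]
    rw [Complex.sq_norm, Complex.sq_norm, Complex.normSq_apply, Complex.normSq_apply]
    simp
    nlinarith [mul_pos (sub_pos.2 hz2) (sub_pos.2 hw2)]
  have hφd : ∀ w ∈ ball (0:ℂ) 1, HasDerivAt φ
      ((1 * (1 + (starRingEnd ℂ) z * w) - (w + z) * ((starRingEnd ℂ) z * 1)) /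
        (1 + (starRingEnd ℂ) z * w) ^ 2) w := by
    intro w hw
    exact ((hasDerivAt_id w).add_const z).div
      (((hasDerivAt_id w).const_mul ((starRingEnd ℂ) z)).const_add 1) (hden w hw)
  have hz2 : (1 - z * (starRingEnd ℂ) z) ≠ 0 := by
    rw [hzz]
    have : (1 - ‖z‖ ^ 2 : ℝ) ≠ 0 := by nlinarith [norm_nonneg z]
    exact_mod_cast this
  have hφi : InjOn φ (ball 0 1) := by
    intro a ha b hb h
    simp only [hφ] at h
    rw [div_eq_div_iff (hden a ha) (hden b hb)] at h
    have : (1 - z * (starRingEnd ℂ) z) * (a - b) = 0 := by linear_combination h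
    rcases mul_eq_zero.1 this with h | h
    · exact absurd h hz2
    · linear_combination h
  have hφ0 : φ 0 = z := by simp [hφ]
  have hφz : φ (-z) = 0 := by simp [hφ]
  have hcd := fun w (hw : w ∈ ball (0:ℂ) 1) => HasDerivAt.comp w
    (hf.differentiableAt (isOpen_ball.mem_nhds (hφm hw))).hasDerivAt (hφd w hw)
  have key := kd_lower (f := f ∘ φ) (z := -z)
    (fun w hw => (hcd w hw).differentiableAt.differentiableWithinAt)
    (hinj.comp hφi hφm) (by simpa using hz)
  rw [(hcd 0 h0).deriv] at key
  simp only [Function.comp, hφ0, hφz, norm_neg] at key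
  rw [norm_sub_rev] at key
  have e : ((1 * (1 + (starRingEnd ℂ) z * 0) - (0 + z) * ((starRingEnd ℂ) z * 1)) /
        (1 + (starRingEnd ℂ) z * 0) ^ 2) = ((1 - ‖z‖ ^ 2 : ℝ) : ℂ) := by
    push_cast
    have := hzz
    push_cast at this
    simp [← this]
  rw [e, norm_mul, Complex.norm_real, Real.norm_of_nonneg (by nlinarith [norm_nonneg z])] at key
  have hp : 0 < 1 + ‖z‖ := by positivity
  have e2 : ‖deriv f z‖ * (1 - ‖z‖ ^ 2) * (‖z‖ / (1 + ‖z‖) ^ 2)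
      = ‖deriv f z‖ * (‖z‖ * (1 - ‖z‖)) / (1 + ‖z‖) := by
    field_simp; ring
  rw [e2, div_le_iff₀ hp] at key
  exact key

/-- Upper bound in the growth theorem. -/
lemma kd_upper {f : ℂ → ℂ} (hf : DifferentiableOn ℂ f (ball 0 1)) (hinj : InjOn f (ball 0 1))
    {z : ℂ} (hz : z ∈ ball (0:ℂ) 1) :
    ‖f z - f 0‖ ≤ ‖deriv f 0‖ * (‖z‖ / (1 - ‖z‖) ^ 2) := by
  rcases eq_or_ne z 0 with rfl | hz0
  · simp
  have h0 : (0:ℂ) ∈ ball (0:ℂ) 1 := by simp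
  set r := ‖z‖ with hr
  have hr0 : 0 < r := norm_pos_iff.2 hz0
  have hr1 : r < 1 := by simpa using hz
  have hrc : (r : ℂ) ≠ 0 := by exact_mod_cast hr0.ne'
  set u : ℂ := z / r with hu
  have hun : ‖u‖ = 1 := by
    rw [hu, norm_div, ← hr, Complex.norm_real, Real.norm_of_nonneg hr0.le, div_self hr0.ne']
  have hzu : z = r * u := by rw [hu]; field_simp
  set F : ℝ → ℂ := fun t => f (t * u) - f 0 with hF
  have hmem : ∀ t ∈ Ioo (-1:ℝ) 1, (t * u : ℂ) ∈ ball (0:ℂ) 1 := by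
    intro t ht
    simpa [hun, abs_lt] using ht
  have hFd : ∀ t ∈ Ioo (-1:ℝ) 1, HasDerivAt F (deriv f (t * u) * u) t := by
    intro t ht
    have h1 : HasDerivAt (fun t : ℝ => (t * u : ℂ)) u t := by
      simpa using (Complex.ofRealCLM.hasDerivAt (x := t)).mul_const u
    have h2 := (hf.differentiableAt (isOpen_ball.mem_nhds (hmem t ht))).hasDerivAt
    exact (HasDerivAt.comp t h2 h1).sub_const _
  set Q : ℝ → ℝ := fun t => ‖F t‖ ^ 2 * ((1 - t) ^ 4 / t ^ 2) with hQ
  have hQd : ∀ t ∈ Ioo (0:ℝ) 1, HasDerivAt Q (2 * inner ℝ (F t) (deriv f (t * u) * u)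
      * ((1 - t) ^ 4 / t ^ 2) + ‖F t‖ ^ 2 * (-2 * (1 - t) ^ 3 * (1 + t) / t ^ 3)) t := by
    intro t ht
    have ht' : t ∈ Ioo (-1:ℝ) 1 := ⟨by linarith [ht.1], ht.2⟩
    have ht0 : t ≠ 0 := ht.1.ne'
    have h1 := (hFd t ht').norm_sq
    have h2 : HasDerivAt (fun t : ℝ => (1 - t) ^ 4 / t ^ 2)
        (-2 * (1 - t) ^ 3 * (1 + t) / t ^ 3) t := by
      have := (((hasDerivAt_id t).const_sub 1).pow 4).div ((hasDerivAt_id t).pow 2)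
        (by simpa using ht0)
      convert! this using 1
      simp; field_simp; ring
    exact h1.mul h2
  have hanti : AntitoneOn Q (Ioo 0 1) := by
    apply antitoneOn_of_deriv_nonpos (convex_Ioo 0 1)
    · intro t ht; exact (hQd t ht).continuousAt.continuousWithinAt
    · intro t ht
      rw [interior_Ioo] at ht
      exact (hQd t ht).differentiableAt.differentiableWithinAt
    · intro t ht
      rw [interior_Ioo] at ht
      rw [(hQd t ht).deriv]
      have ht' : t ∈ Ioo (-1:ℝ) 1 := ⟨by linarith [ht.1], ht.2⟩
      have ht0 := ht.1
      have h1t : 0 < 1 - t := by linarith [ht.2]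
      have key := kd_logderiv hf hinj (hmem t ht')
      have hnt : ‖(t * u : ℂ)‖ = t := by simp [hun, abs_of_pos ht0]
      rw [hnt] at key
      have hin : inner ℝ (F t) (deriv f (t * u) * u) ≤ ‖F t‖ * ‖deriv f (t * u)‖ := by
        refine (real_inner_le_norm _ _).trans ?_
        simp [hun]
      have e : 2 * inner ℝ (F t) (deriv f (t * u) * u)
          * ((1 - t) ^ 4 / t ^ 2) + ‖F t‖ ^ 2 * (-2 * (1 - t) ^ 3 * (1 + t) / t ^ 3)
          = (2 * (1 - t) ^ 3 / t ^ 3) * (inner ℝ (F t) (deriv f (t * u) * u) * (t * (1 - t))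
            - ‖F t‖ * (‖F t‖ * (1 + t))) := by
        field_simp
        ring
      rw [e]
      apply mul_nonpos_of_nonneg_of_nonpos (by positivity)
      have h3 := mul_le_mul_of_nonneg_right hin (mul_pos ht0 h1t).le
      have h4 := mul_le_mul_of_nonneg_left key (norm_nonneg (F t))
      have h5 : ‖F t‖ * ‖f (t * u) - f 0‖ = ‖F t‖ * ‖F t‖ := rfl
      nlinarith
  have hlim : Tendsto Q (𝓝[>] 0) (𝓝 (‖deriv f 0‖ ^ 2)) := by
    have h1 := (hFd 0 (by simp))
    rw [hasDerivAt_iff_tendsto_slope] at h1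
    have h2 : Tendsto (fun t => ‖slope F 0 t‖ ^ 2 * (1 - t) ^ 4) (𝓝[>] 0)
        (𝓝 (‖deriv f ((0:ℝ) * u) * u‖ ^ 2 * (1 - 0) ^ 4)) := by
      apply Tendsto.mul
      · exact ((h1.norm.pow 2).mono_left (nhdsWithin_mono _ (fun x hx => ne_of_gt hx)))
      · have : Continuous (fun t : ℝ => (1 - t) ^ 4) := by fun_prop
        exact this.continuousAt.tendsto.mono_left nhdsWithin_le_nhds
    simp only [norm_mul, hun] at h2
    simp only [Complex.ofReal_zero, zero_mul, mul_one, sub_zero, one_pow] at h2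
    refine h2.congr' ?_
    filter_upwards [self_mem_nhdsWithin] with t ht
    have ht0 : (0:ℝ) < t := ht
    have hF0 : F 0 = 0 := by simp [hF]
    simp only [slope, hQ, hF0, vsub_eq_sub, sub_zero, norm_smul, norm_inv,
      Real.norm_of_nonneg ht0.le]
    field_simp
  have hle : Q r ≤ ‖deriv f 0‖ ^ 2 := by
    refine ge_of_tendsto hlim ?_
    filter_upwards [Ioo_mem_nhdsGT hr0] with t ht
    exact hanti ⟨ht.1, ht.2.trans hr1⟩ ⟨hr0, hr1⟩ ht.2.le
  have hFr : F r = f z - f 0 := by simp only [hF, ← hzu]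
  have h1r : 0 < 1 - r := by linarith
  have hQr : Q r = (‖f z - f 0‖ * ((1 - r) ^ 2 / r)) ^ 2 := by
    simp only [hQ, hFr]; ring
  rw [hQr] at hle
  have h := le_of_sq_le_sq hle (norm_nonneg _)
  have e : ‖f z - f 0‖ = ‖f z - f 0‖ * ((1 - r) ^ 2 / r) * (r / (1 - r) ^ 2) := by
    field_simp
  rw [e]
  gcongr

/-- **Koebe distortion on an arbitrary disk.** If `f` is holomorphic and
injective on the disk `B(z₀, R)`, then for every `z` in the disk
`(|z-z₀|/R)/(1+|z-z₀|/R)² ≤ |f(z)-f(z₀)|/(R·|f'(z₀)|) ≤ (|z-z₀|/R)/(1-|z-z₀|/R)²`. -/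
theorem koebe_distortion_ball (z₀ : ℂ) (R : ℝ) (hR : 0 < R) (f : ℂ → ℂ)
    (hf : DifferentiableOn ℂ f (Metric.ball z₀ R))
    (hinj : Set.InjOn f (Metric.ball z₀ R)) :
    ∀ z ∈ Metric.ball z₀ R,
      (‖z - z₀‖ / R) / (1 + ‖z - z₀‖ / R) ^ 2
          ≤ ‖f z - f z₀‖ / (R * ‖deriv f z₀‖) ∧
      ‖f z - f z₀‖ / (R * ‖deriv f z₀‖)
          ≤ (‖z - z₀‖ / R) / (1 - ‖z - z₀‖ / R) ^ 2 := by
  intro z hz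
  have hd := kd_deriv_ne_zero hR hf hinj
  have hRc : (R : ℂ) ≠ 0 := by exact_mod_cast hR.ne'
  set A : ℂ → ℂ := fun w => z₀ + R * w with hA
  have hAm : MapsTo A (ball 0 1) (ball z₀ R) := by
    intro w hw
    have : ‖w‖ < 1 := by simpa using hw
    simp [hA, abs_of_pos hR]
    nlinarith
  have hAi : Function.Injective A := by
    intro a b h
    simpa [hA, hRc] using h
  have hAd : ∀ w, HasDerivAt A R w := by
    intro w
    have := ((hasDerivAt_id w).const_mul (R:ℂ)).const_add z₀
    rw [mul_one] at this
    exact this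
  have hA0 : A 0 = z₀ := by simp [hA]
  have hcd := fun w (hw : w ∈ ball (0:ℂ) 1) => HasDerivAt.comp w
    (hf.differentiableAt (isOpen_ball.mem_nhds (hAm hw))).hasDerivAt (hAd w)
  have hgd : DifferentiableOn ℂ (f ∘ A) (ball 0 1) :=
    fun w hw => (hcd w hw).differentiableAt.differentiableWithinAt
  have hgi : InjOn (f ∘ A) (ball 0 1) := hinj.comp hAi.injOn hAm
  set w : ℂ := (z - z₀) / R with hw
  have hwn : ‖w‖ = ‖z - z₀‖ / R := by
    rw [hw, norm_div, Complex.norm_real, Real.norm_of_nonneg hR.le]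
  have hwm : w ∈ ball (0:ℂ) 1 := by
    rw [mem_ball_zero_iff, hwn, div_lt_one hR, ← dist_eq_norm]; exact hz
  have hAw : A w = z := by simp only [hA, hw]; field_simp; ring
  have h1 := kd_lower hgd hgi hwm
  have h2 := kd_upper hgd hgi hwm
  rw [(hcd 0 (by simp)).deriv] at h1 h2
  simp only [Function.comp, hA0, hAw, norm_mul, Complex.norm_real, Real.norm_of_nonneg hR.le,
    hwn] at h1 h2
  have hpos : 0 < R * ‖deriv f z₀‖ := mul_pos hR (norm_pos_iff.2 hd)
  rw [le_div_iff₀ hpos, div_le_iff₀ hpos]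
  constructor
  · linarith
  · linarith
end

section
/- Let Φ be holomorphic and injective on the open disk B(z₀, R) = {z ∈ ℂ : |z − z₀| < R}, R > 0, and let w ∈ B(z₀, R) with w ≠ z₀ satisfy |Φ(w) − Φ(z₀)| = 1. Then (1 − |w − z₀|/R)²/|w − z₀| ≤ |Φ'(z₀)| ≤ (1 + |w − z₀|/R)²/|w − z₀|. -/
open Complex MeasureTheory Metric Set

lemma koebe_mean_zero (M : ℂ → ℂ) (hM : DifferentiableOn ℂ M (ball 0 1)) (h0 : M 0 = 0)
    {r : ℝ} (hr : 0 < r) (hr1 : r < 1) :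
    ∫ θ in (-Real.pi)..Real.pi, (M (circleMap 0 r θ)).re = 0 := by
  have h1 : DiffContOnCl ℂ M (ball 0 |r|) := by
    rw [abs_of_pos hr]
    apply DifferentiableOn.diffContOnCl
    rw [closure_ball _ hr.ne']
    exact hM.mono (closedBall_subset_ball hr1)
  have h2 := h1.circleAverage
  rw [h0, Real.circleAverage] at h2
  have h3 : ∫ θ in (0:ℝ)..2 * Real.pi, M (circleMap 0 r θ) = 0 := by
    have := Real.pi_pos
    simpa [this.ne'] using h2
  have h4 : ∫ θ in (-Real.pi)..Real.pi, M (circleMap 0 r θ) = 0 := by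
    have hp : Function.Periodic (fun θ => M (circleMap 0 r θ)) (2 * Real.pi) := by
      intro θ; simp only [periodic_circleMap 0 r θ]
    have := hp.intervalIntegral_add_eq (-Real.pi) 0
    rw [show -Real.pi + 2 * Real.pi = Real.pi by ring, zero_add, h3] at this
    exact this
  have hcont : Continuous (fun θ => M (circleMap 0 r θ)) := by
    apply hM.continuousOn.comp_continuous (continuous_circleMap 0 r)
    intro θ
    simp [abs_of_pos hr, hr1]
  have h5 := Complex.reCLM.intervalIntegral_comp_comm (hcont.intervalIntegrable (μ := volume) (-Real.pi) Real.pi)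
  simp only [Complex.reCLM_apply] at h5
  rw [h5, h4]; simp

lemma koebe_circle_bound (b : ℂ) (Q : ℂ → ℂ) (hQ : DifferentiableOn ℂ Q (ball 0 1)) (h0 : Q 0 = 0)
    {r : ℝ} (hr : 0 < r) (hr1 : r < 1) :
    2 * Real.pi * (1 / r ^ 4 + ‖b‖ ^ 2) ≤
     ∫ θ in (-Real.pi)..Real.pi, ‖-1 / (circleMap 0 r θ) ^ 2 + b + Q (circleMap 0 r θ)‖ ^ 2 := by
  set M : ℂ → ℂ := fun z => 2 * Q z * (starRingEnd ℂ b - z ^ 2 / (r:ℂ) ^ 4) - 2 * b * z ^ 2 / (r:ℂ) ^ 4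
    with hMdef
  have hM : DifferentiableOn ℂ M (ball 0 1) := by
    intro z hz
    have := hQ z hz
    fun_prop
  have hM0 : M 0 = 0 := by simp [hMdef, h0]
  have hz := koebe_mean_zero M hM hM0 hr hr1
  have hcM : Continuous (fun θ => M (circleMap 0 r θ)) := by
    apply hM.continuousOn.comp_continuous (continuous_circleMap 0 r)
    intro θ
    simp [abs_of_pos hr, hr1]
  have hcQ : Continuous (fun θ => Q (circleMap 0 r θ)) := by
    apply hQ.continuousOn.comp_continuous (continuous_circleMap 0 r)
    intro θ
    simp [abs_of_pos hr, hr1]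
  have hcR : Continuous (fun θ => (M (circleMap 0 r θ)).re) := Complex.continuous_re.comp hcM
  have hne : ∀ θ, circleMap 0 r θ ≠ 0 := fun θ => by simp [hr.ne']
  have key : ∀ θ, 1 / r ^ 4 + ‖b‖ ^ 2 + (M (circleMap 0 r θ)).re ≤
      ‖-1 / (circleMap 0 r θ) ^ 2 + b + Q (circleMap 0 r θ)‖ ^ 2 := by
    intro θ
    have hzz : (starRingEnd ℂ) (circleMap 0 r θ) = r ^ 2 / circleMap 0 r θ := by
      rw [eq_div_iff (hne θ), mul_comm, Complex.mul_conj, Complex.normSq_eq_norm_sq]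
      simp
    set z := circleMap 0 r θ with hzdef
    have hzn : z ≠ 0 := hne θ
    have hrn : (r:ℂ) ≠ 0 := by exact_mod_cast hr.ne'
    have hid : ((‖-1 / z ^ 2 + b + Q z‖ ^ 2 : ℝ) : ℂ) =
      1 / r ^ 4 + ‖b‖ ^ 2 + (M z + starRingEnd ℂ (M z)) / 2 + ‖Q z‖ ^ 2 := by
      push_cast
      rw [← Complex.mul_conj', ← Complex.mul_conj', ← Complex.mul_conj']
      simp only [hMdef, map_add, map_sub, map_mul, map_div₀, map_pow, map_neg, map_one, hzz,
        Complex.conj_conj, Complex.conj_ofReal, map_ofNat]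
      field_simp
      ring
    have hid2 := congrArg Complex.re hid
    have hcast : (1 / (r:ℂ) ^ 4 + (‖b‖:ℂ) ^ 2 + (M z + starRingEnd ℂ (M z)) / 2 + (‖Q z‖:ℂ) ^ 2)
      = ((1 / r ^ 4 + ‖b‖ ^ 2 + (M z).re + ‖Q z‖ ^ 2 : ℝ) : ℂ) := by
      rw [Complex.add_conj]; push_cast; ring
    rw [hcast, Complex.ofReal_re, Complex.ofReal_re] at hid2
    rw [hid2]; nlinarith [sq_nonneg ‖Q z‖]
  have hle := intervalIntegral.integral_mono_on (μ := volume) (a := -Real.pi) (b := Real.pi)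
    (by linarith [Real.pi_pos])
    (f := fun θ => 1 / r ^ 4 + ‖b‖ ^ 2 + (M (circleMap 0 r θ)).re)
    (g := fun θ => ‖-1 / (circleMap 0 r θ) ^ 2 + b + Q (circleMap 0 r θ)‖ ^ 2)
    (Continuous.intervalIntegrable (continuous_const.add hcR) _ _)
    (Continuous.intervalIntegrable (by
      have : Continuous fun θ => -1 / (circleMap 0 r θ) ^ 2 :=
        continuous_const.div (by fun_prop) (fun θ => pow_ne_zero _ (hne θ))
      exact (((this.add continuous_const).add hcQ).norm).pow 2) _ _)
    (fun θ _ => key θ)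
  rw [intervalIntegral.integral_add (by simp) (hcR.intervalIntegrable _ _), hz] at hle
  simp only [intervalIntegral.integral_const, smul_eq_mul, add_zero] at hle
  linarith

lemma koebe_det (c β : ℂ) :
    ((ContinuousLinearMap.id ℝ ℂ - (ContinuousLinearMap.mul ℝ ℂ β) ∘L (Complex.conjCLE : ℂ →L[ℝ] ℂ)) ∘L
      (ContinuousLinearMap.mul ℝ ℂ c)).det = (1 - ‖β‖ ^ 2) * ‖c‖ ^ 2 := by
  rw [ContinuousLinearMap.det, ← LinearMap.det_toMatrix Complex.basisOneI, Matrix.det_fin_two]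
  simp [LinearMap.toMatrix_apply, ← Complex.normSq_eq_norm_sq, Complex.normSq_apply]
  ring

lemma koebe_annulus_bound (b : ℂ) (Q : ℂ → ℂ) (hQ : DifferentiableOn ℂ Q (ball 0 1)) (h0 : Q 0 = 0)
    {ε ρ : ℝ} (hε : 0 < ε) (hερ : ε < ρ) (hρ : ρ < 1) :
    ENNReal.ofReal (Real.pi * (1 / ε ^ 2 - 1 / ρ ^ 2) + Real.pi * ‖b‖ ^ 2 * (ρ ^ 2 - ε ^ 2)) ≤
     ∫⁻ z in {z : ℂ | ε < ‖z‖ ∧ ‖z‖ < ρ}, ENNReal.ofReal (‖-1 / z ^ 2 + b + Q z‖ ^ 2) := by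
  have hA : MeasurableSet {z : ℂ | ε < ‖z‖ ∧ ‖z‖ < ρ} :=
    ((isOpen_lt continuous_const continuous_norm).inter
      (isOpen_lt continuous_norm continuous_const)).measurableSet
  set D : ℂ → ℝ := fun z => ‖-1 / z ^ 2 + b + Q z‖ ^ 2 with hD
  have hDc : ContinuousOn D {z : ℂ | 0 < ‖z‖ ∧ ‖z‖ < 1} := by
    have h1 : ContinuousOn Q {z : ℂ | 0 < ‖z‖ ∧ ‖z‖ < 1} :=
      hQ.continuousOn.mono (fun z hz => by simpa using hz.2)
    have h2 : ContinuousOn (fun z : ℂ => -1 / z ^ 2) {z : ℂ | 0 < ‖z‖ ∧ ‖z‖ < 1} :=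
      continuousOn_const.div (by fun_prop) (fun z hz => pow_ne_zero _ (norm_pos_iff.1 hz.1))
    exact (((h2.add continuousOn_const).add h1).norm).pow 2
  have hps : ∀ p : ℝ × ℝ, Complex.polarCoord.symm p = circleMap 0 p.1 p.2 := by
    intro p
    rw [Complex.polarCoord_symm_apply, circleMap, Complex.exp_mul_I]; simp
  rw [← lintegral_indicator hA, ← Complex.lintegral_comp_polarCoord_symm]
  have hsub : Ioo ε ρ ×ˢ Ioo (-Real.pi) Real.pi ⊆ polarCoord.target := by
    rintro ⟨x, y⟩ ⟨hx, hy⟩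
    exact ⟨hε.trans hx.1, hy⟩
  refine le_trans ?_ (lintegral_mono_set hsub)
  have hmS : MeasurableSet (Ioo ε ρ ×ˢ Ioo (-Real.pi) Real.pi) := measurableSet_Ioo.prod measurableSet_Ioo
  have hcongr : ∫⁻ p in Ioo ε ρ ×ˢ Ioo (-Real.pi) Real.pi, ENNReal.ofReal p.1 •
      ({z : ℂ | ε < ‖z‖ ∧ ‖z‖ < ρ}.indicator (fun z => ENNReal.ofReal (D z)))
        (Complex.polarCoord.symm p) =
      ∫⁻ p in Ioo ε ρ ×ˢ Ioo (-Real.pi) Real.pi, ENNReal.ofReal (p.1 * D (circleMap 0 p.1 p.2)) := by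
    apply setLIntegral_congr_fun hmS
    rintro ⟨x, y⟩ ⟨hx, hy⟩
    have hx0 : 0 < x := hε.trans hx.1
    simp only [hps]
    rw [indicator_of_mem, smul_eq_mul, ENNReal.ofReal_mul hx0.le]
    simpa [abs_of_pos hx0] using hx
  rw [hcongr, Measure.volume_eq_prod, ← Measure.prod_restrict]
  have hcont : ContinuousOn (fun p : ℝ × ℝ => p.1 * D (circleMap 0 p.1 p.2))
      (Ioo ε ρ ×ˢ Ioo (-Real.pi) Real.pi) := by
    apply continuousOn_fst.mul
    apply hDc.comp
    · simp only [circleMap]; fun_prop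
    · rintro ⟨x, y⟩ ⟨hx, hy⟩
      have hx0 : 0 < x := hε.trans hx.1
      have hx1 : x < 1 := hx.2.trans hρ
      simpa [abs_of_pos hx0] using ⟨hx0.ne', hx1⟩
  rw [lintegral_prod _ (by
    rw [Measure.prod_restrict]
    exact (hcont.aemeasurable hmS).ennreal_ofReal)]
  have hin : ∀ x ∈ Ioo ε ρ, ENNReal.ofReal (x * (2 * Real.pi * (1 / x ^ 4 + ‖b‖ ^ 2))) ≤
      ∫⁻ y in Ioo (-Real.pi) Real.pi, ENNReal.ofReal (x * D (circleMap 0 x y)) := by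
    intro x hx
    have hx0 : 0 < x := hε.trans hx.1
    have hx1 : x < 1 := hx.2.trans hρ
    have hcx : Continuous (fun y => x * D (circleMap 0 x y)) := by
      apply continuous_const.mul
      apply hDc.comp_continuous (continuous_circleMap 0 x)
      intro y
      simpa [abs_of_pos hx0] using ⟨hx0.ne', hx1⟩
    rw [← ofReal_integral_eq_lintegral_ofReal
      ((hcx.integrableOn_Icc (a := -Real.pi) (b := Real.pi)).mono_set Ioo_subset_Icc_self)
      (Filter.Eventually.of_forall fun y => mul_nonneg hx0.le (by positivity))]
    apply ENNReal.ofReal_le_ofReal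
    rw [← integral_Ioc_eq_integral_Ioo, ← intervalIntegral.integral_of_le (by linarith [Real.pi_pos]),
      intervalIntegral.integral_const_mul]
    exact mul_le_mul_of_nonneg_left (koebe_circle_bound b Q hQ h0 hx0 hx1) hx0.le
  refine le_trans ?_ (setLIntegral_mono' measurableSet_Ioo hin)
  have hc2 : ContinuousOn (fun x : ℝ => x * (2 * Real.pi * (1 / x ^ 4 + ‖b‖ ^ 2))) (Icc ε ρ) := by
    have : ContinuousOn (fun x : ℝ => 1 / x ^ 4) (Icc ε ρ) :=
      continuousOn_const.div (by fun_prop) (fun x hx => pow_ne_zero _ (hε.trans_le hx.1).ne')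
    exact continuousOn_id.mul (continuousOn_const.mul (this.add continuousOn_const))
  rw [← ofReal_integral_eq_lintegral_ofReal
      ((hc2.integrableOn_Icc).mono_set Ioo_subset_Icc_self)
      (by
        filter_upwards [ae_restrict_mem measurableSet_Ioo] with x hx
        have hx0 : 0 < x := hε.trans hx.1
        have := Real.pi_pos
        simp only [Pi.zero_apply]; positivity)]
  apply ENNReal.ofReal_le_ofReal
  rw [← integral_Ioc_eq_integral_Ioo, ← intervalIntegral.integral_of_le hερ.le]
  have hder : ∀ x ∈ uIcc ε ρ, HasDerivAt (fun x : ℝ => -Real.pi * (x ^ 2)⁻¹ + Real.pi * ‖b‖ ^ 2 * x ^ 2)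
      (x * (2 * Real.pi * (1 / x ^ 4 + ‖b‖ ^ 2))) x := by
    intro x hx
    rw [uIcc_of_le hερ.le] at hx
    have hx0 : x ≠ 0 := (hε.trans_le hx.1).ne'
    have h1 := (((hasDerivAt_pow 2 x).inv (pow_ne_zero _ hx0)).const_mul (-Real.pi)).add
      ((hasDerivAt_pow 2 x).const_mul (Real.pi * ‖b‖ ^ 2))
    convert! h1 using 1
    push_cast
    field_simp
  rw [intervalIntegral.integral_eq_sub_of_hasDerivAt hder
    ((by rw [uIcc_of_le hερ.le]; exact hc2 : ContinuousOn _ (uIcc ε ρ)).intervalIntegrable)]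
  apply le_of_eq
  simp only [one_div]
  ring

lemma koebe_pointwise {B C ε x : ℝ} (hB : 0 ≤ B) (hC : 0 ≤ C) (hε : 0 < ε) (hεx : ε < x) (hx1 : x < 1)
    (h2 : ε * (2 * (B + B ^ 2 + C * (1 + B)) + 4 * B + 1) ≤ 1) :
    1 / x + B * (x - ε ^ 2 / x) + B ^ 2 * ε ^ 2 * x + C * x ^ 2 * (1 + B * ε ^ 2)
      ≤ 1 / ε + (B ^ 2 + 4 * C * (1 + B)) * ε ^ 2 := by
  have hx0 : 0 < x := hε.trans hεx
  have hBC : 0 ≤ C * (1 + B) := by positivity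
  have hε1 : ε ≤ 1 := by nlinarith [mul_nonneg hε.le hB, mul_nonneg hε.le hBC, mul_nonneg hε.le (sq_nonneg B)]
  have hBe : ε * (4 * B) ≤ 1 := by nlinarith [mul_nonneg hε.le hB, mul_nonneg hε.le hBC, mul_nonneg hε.le (sq_nonneg B)]
  have hbig : ε * (2 * (B + B ^ 2 + C * (1 + B))) ≤ 1 := by nlinarith [mul_nonneg hε.le hB]
  have hε2 : ε ^ 2 ≤ 1 := by nlinarith
  have hCB : C * x ^ 2 * (1 + B * ε ^ 2) ≤ C * (1 + B) * x ^ 2 := by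
    have : B * ε ^ 2 ≤ B := by nlinarith
    calc C * x ^ 2 * (1 + B * ε ^ 2) ≤ C * x ^ 2 * (1 + B) := by gcongr
      _ = _ := by ring
  have hB2 : B ^ 2 * ε ^ 2 * x ≤ B ^ 2 * ε ^ 2 := by
    have : 0 ≤ B ^ 2 * ε ^ 2 := by positivity
    nlinarith
  rcases le_total x (2 * ε) with h | h
  · have h3 : 1 / x + B * (x - ε ^ 2 / x) ≤ 1 / ε := by
      have : 1 / ε - (1 / x + B * (x - ε ^ 2 / x)) = (x - ε) * (1 - B * ε * (x + ε)) / (ε * x) := by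
        field_simp; ring
      have h4 : 0 ≤ (x - ε) * (1 - B * ε * (x + ε)) / (ε * x) := by
        apply div_nonneg _ (by positivity)
        apply mul_nonneg (by linarith)
        have : B * ε * (x + ε) ≤ B * ε * 2 := by gcongr; linarith
        nlinarith [mul_nonneg hε.le hB]
      linarith
    have h5 : C * (1 + B) * x ^ 2 ≤ C * (1 + B) * (2 * ε) ^ 2 := by gcongr
    nlinarith
  · have h3 : 1 / x ≤ 1 / (2 * ε) := by gcongr
    have h4 : B * (x - ε ^ 2 / x) ≤ B := by
      have : 0 ≤ ε ^ 2 / x := by positivity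
      nlinarith
    have h5 : C * (1 + B) * x ^ 2 ≤ C * (1 + B) := by
      have : x ^ 2 ≤ 1 := by nlinarith
      nlinarith
    have h6 : B ^ 2 * ε ^ 2 ≤ B ^ 2 := by nlinarith [sq_nonneg B]
    have h7 : B + B ^ 2 + C * (1 + B) ≤ 1 / (2 * ε) := by
      rw [le_div_iff₀ (by positivity)]; linarith
    have h8 : 1 / ε = 1 / (2 * ε) + 1 / (2 * ε) := by field_simp; ring
    have h9 : 0 ≤ (B ^ 2 + 4 * C * (1 + B)) * ε ^ 2 := by positivity
    linarith

lemma koebe_area_ineq (b : ℂ) (s : ℂ → ℂ) (hs : DifferentiableOn ℂ s (ball 0 1))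
    (hinj : InjOn (fun z => 1 / z + b * z + z ^ 2 * s z) (ball 0 1 \ {0}))
    {ρ : ℝ} (hρ0 : 0 < ρ) (hρ : ρ < 1) :
    ∃ K : ℝ, 0 ≤ K ∧ ∃ δ > 0, ∀ ε : ℝ, 0 < ε → ε < δ →
      (1 - ‖b‖ ^ 2 * ε ^ 4) * ((1 / ε ^ 2 - 1 / ρ ^ 2) + ‖b‖ ^ 2 * (ρ ^ 2 - ε ^ 2)) ≤
        (1 / ε + K * ε ^ 2) ^ 2 := by
  obtain ⟨C, hC⟩ := (isCompact_closedBall (0:ℂ) ρ).exists_bound_of_continuousOn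
    (hs.continuousOn.mono (closedBall_subset_ball hρ))
  have hC0 : 0 ≤ C := (norm_nonneg _).trans (hC 0 (by simp [hρ0.le]))
  set B := ‖b‖ with hBdef
  have hB : 0 ≤ B := norm_nonneg b
  refine ⟨B ^ 2 + 4 * C * (1 + B), by positivity,
    min ρ (1 / (2 * (B + B ^ 2 + C * (1 + B)) + 4 * B + 1)), by positivity, ?_⟩
  intro ε hε hεδ
  have hερ : ε < ρ := hεδ.trans_le (min_le_left _ _)
  have hε2 : ε * (2 * (B + B ^ 2 + C * (1 + B)) + 4 * B + 1) ≤ 1 := by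
    have := (hεδ.trans_le (min_le_right _ _)).le
    rwa [le_div_iff₀ (by positivity)] at this
  set K := B ^ 2 + 4 * C * (1 + B) with hK
  have hK0 : 0 ≤ K := by positivity
  set A := {z : ℂ | ε < ‖z‖ ∧ ‖z‖ < ρ} with hAdef
  have hA : MeasurableSet A :=
    ((isOpen_lt continuous_const continuous_norm).inter
      (isOpen_lt continuous_norm continuous_const)).measurableSet
  set h : ℂ → ℂ := fun z => 1 / z + b * z + z ^ 2 * s z with hh
  set Q : ℂ → ℂ := fun z => 2 * z * s z + z ^ 2 * deriv s z with hQdef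
  set β : ℂ := b * (ε:ℂ) ^ 2 with hβ
  have hβn : ‖β‖ = B * ε ^ 2 := by simp [hβ, abs_of_pos hε, hBdef]
  have hβ1 : ‖β‖ < 1 := by
    rw [hβn]
    have hBC : 0 ≤ C * (1 + B) := by positivity
    have e1 : ε < 1 := hερ.trans hρ
    have e2 : ε * (4 * B) ≤ 1 := by
      nlinarith [mul_nonneg hε.le hB, mul_nonneg hε.le hBC, mul_nonneg hε.le (sq_nonneg B)]
    nlinarith [mul_nonneg hε.le hB]
  have hQ : DifferentiableOn ℂ Q (ball 0 1) := by
    have := hs.deriv isOpen_ball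
    intro z hz
    have h1 := this z hz
    have h2 := hs z hz
    fun_prop
  have hAb : ∀ z ∈ A, z ∈ ball (0:ℂ) 1 ∧ z ≠ 0 := by
    rintro z ⟨h1, h2⟩
    exact ⟨by simpa using h2.trans hρ, norm_pos_iff.1 (hε.trans h1)⟩
  have hder : ∀ z ∈ A, HasDerivAt h (-1 / z ^ 2 + b + Q z) z := by
    intro z hz
    obtain ⟨h1, h2⟩ := hAb z hz
    have h3 := (hs.differentiableAt (isOpen_ball.mem_nhds h1)).hasDerivAt
    have h4 := ((hasDerivAt_inv h2).add ((hasDerivAt_id z).const_mul b)).add ((hasDerivAt_pow 2 z).mul h3)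
    convert! h4 using 1
    · ext y; simp [hh]
    · simp [hQdef]; field_simp
  set L : ℂ →L[ℝ] ℂ := ContinuousLinearMap.id ℝ ℂ -
    (ContinuousLinearMap.mul ℝ ℂ β) ∘L (Complex.conjCLE : ℂ →L[ℝ] ℂ) with hL
  have hLap : ∀ v, L v = v - β * (starRingEnd ℂ) v := by intro v; simp [hL]
  have hfd : ∀ z ∈ A, HasFDerivWithinAt (fun z => L (h z))
      (L ∘L (ContinuousLinearMap.mul ℝ ℂ (-1 / z ^ 2 + b + Q z))) A z := by
    intro z hz
    have h1 := (hder z hz).hasFDerivAt.restrictScalars ℝ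
    have h2 := (L.hasFDerivAt (x := h z)).comp z h1
    have h3 : (ContinuousLinearMap.restrictScalars ℝ
        (ContinuousLinearMap.toSpanSingleton ℂ (-1 / z ^ 2 + b + Q z))) =
        ContinuousLinearMap.mul ℝ ℂ (-1 / z ^ 2 + b + Q z) := by
      ext v; simp
      all_goals ring
    rw [← h3]
    exact h2.hasFDerivWithinAt
  have hLinj : ∀ u v, L u = L v → u = v := by
    intro u v huv
    rw [hLap, hLap] at huv
    have h1 : u - v = β * (starRingEnd ℂ) (u - v) := by rw [map_sub]; linear_combination huv
    have h2 : ‖u - v‖ = ‖β‖ * ‖u - v‖ := by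
      conv_lhs => rw [h1]
      rw [norm_mul, RCLike.norm_conj]
    by_contra hne
    have : 0 < ‖u - v‖ := norm_pos_iff.2 (sub_ne_zero.2 hne)
    nlinarith
  have hHinj : InjOn (fun z => L (h z)) A := by
    intro z hz w hw hzw
    obtain ⟨h1, h2⟩ := hAb z hz
    obtain ⟨h3, h4⟩ := hAb w hw
    exact hinj ⟨h1, by simpa using h2⟩ ⟨h3, by simpa using h4⟩ (hLinj _ _ hzw)
  have hvol := lintegral_abs_det_fderiv_eq_addHaar_image volume hA hfd hHinj
  have himg : (fun z => L (h z)) '' A ⊆ closedBall 0 (1 / ε + K * ε ^ 2) := by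
    rintro _ ⟨z, hz, rfl⟩
    obtain ⟨h1, h2⟩ := hAb z hz
    have hz0 : 0 < ‖z‖ := norm_pos_iff.2 h2
    simp only [mem_closedBall, dist_zero_right]
    refine le_trans ?_ (koebe_pointwise hB hC0 hε hz.1 (hz.2.trans hρ) hε2)
    have hcz : (starRingEnd ℂ) z = (‖z‖:ℂ) ^ 2 / z := by
      rw [eq_div_iff h2, mul_comm, Complex.mul_conj']
    have e1 : L (h z) = 1 / z + b * ((1 - ε ^ 2 / ‖z‖ ^ 2 : ℝ) * z) - b * (starRingEnd ℂ b) * ε ^ 2 * (starRingEnd ℂ z)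
        + (z ^ 2 * s z - β * starRingEnd ℂ (z ^ 2 * s z)) := by
      have hzn : (‖z‖:ℂ) ≠ 0 := by exact_mod_cast hz0.ne'
      rw [hLap]
      simp only [hh, hβ, map_add, map_mul, map_div₀, map_one, map_pow, hcz]
      push_cast
      field_simp
      ring
    have n2 : ‖b * ((1 - ε ^ 2 / ‖z‖ ^ 2 : ℝ) * z)‖ = B * (‖z‖ - ε ^ 2 / ‖z‖) := by
      have : 0 ≤ 1 - ε ^ 2 / ‖z‖ ^ 2 := by
        rw [sub_nonneg, div_le_one (by positivity)]
        exact pow_le_pow_left₀ hε.le hz.1.le 2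
      rw [norm_mul, norm_mul, Complex.norm_real, Real.norm_of_nonneg this, ← hBdef]
      field_simp
    have n3 : ‖b * (starRingEnd ℂ b) * ε ^ 2 * (starRingEnd ℂ z)‖ = B ^ 2 * ε ^ 2 * ‖z‖ := by
      rw [norm_mul, norm_mul, norm_mul, RCLike.norm_conj, RCLike.norm_conj, norm_pow, Complex.norm_real,
        Real.norm_of_nonneg hε.le, ← hBdef]; ring
    have n4 : ‖z ^ 2 * s z - β * starRingEnd ℂ (z ^ 2 * s z)‖ ≤ C * ‖z‖ ^ 2 * (1 + B * ε ^ 2) := by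
      have h5 : ‖z ^ 2 * s z‖ ≤ C * ‖z‖ ^ 2 := by
        rw [norm_mul, norm_pow, mul_comm]
        have := hC z (by simpa using hz.2.le)
        gcongr
      calc _ ≤ ‖z ^ 2 * s z‖ + ‖β * starRingEnd ℂ (z ^ 2 * s z)‖ := norm_sub_le _ _
        _ = ‖z ^ 2 * s z‖ * (1 + B * ε ^ 2) := by
          rw [norm_mul β, RCLike.norm_conj, hβn]; ring
        _ ≤ _ := by gcongr
    rw [e1]
    calc _ ≤ ‖1 / z‖ + ‖b * ((1 - ε ^ 2 / ‖z‖ ^ 2 : ℝ) * z)‖ + ‖b * (starRingEnd ℂ b) * ε ^ 2 * (starRingEnd ℂ z)‖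
          + ‖z ^ 2 * s z - β * starRingEnd ℂ (z ^ 2 * s z)‖ := by
          refine (norm_add_le _ _).trans ?_
          gcongr
          refine (norm_sub_le _ _).trans ?_
          gcongr
          exact norm_add_le _ _
      _ ≤ _ := by
          rw [n2, n3]
          have : ‖1 / z‖ = 1 / ‖z‖ := by simp
          rw [this]
          gcongr
  have hle := measure_mono (μ := volume) himg
  rw [← hvol, Complex.volume_closedBall] at hle
  have hb2 : 0 ≤ 1 - ‖β‖ ^ 2 := by nlinarith [norm_nonneg β]
  have hlint : ∫⁻ z in A, ENNReal.ofReal |(L ∘L (ContinuousLinearMap.mul ℝ ℂ (-1 / z ^ 2 + b + Q z))).det|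
     = ENNReal.ofReal (1 - ‖β‖ ^ 2) * ∫⁻ z in A, ENNReal.ofReal (‖-1 / z ^ 2 + b + Q z‖ ^ 2) := by
    rw [← lintegral_const_mul' _ _ ENNReal.ofReal_ne_top]
    congr 1
    ext z
    rw [hL, koebe_det, abs_of_nonneg (by positivity), ENNReal.ofReal_mul hb2]
  rw [hlint] at hle
  have hlow := koebe_annulus_bound b Q hQ (by simp [hQdef]) hε hερ hρ
  have h10 := (mul_le_mul_right hlow (ENNReal.ofReal (1 - ‖β‖ ^ 2))).trans hle
  have hpi : (NNReal.pi : ENNReal) = ENNReal.ofReal Real.pi := by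
    rw [← NNReal.coe_real_pi, ENNReal.ofReal_coe_nnreal]
  have hR0 : 0 ≤ 1 / ε + K * ε ^ 2 := by positivity
  rw [hpi, ← ENNReal.ofReal_pow hR0, ← ENNReal.ofReal_mul hb2,
    ← ENNReal.ofReal_mul (by positivity), ENNReal.ofReal_le_ofReal_iff (by have := Real.pi_pos; positivity), hβn] at h10
  have hpos := Real.pi_pos
  have h11 : Real.pi * ((1 - B ^ 2 * ε ^ 4) * ((1 / ε ^ 2 - 1 / ρ ^ 2) + B ^ 2 * (ρ ^ 2 - ε ^ 2))) ≤
        Real.pi * (1 / ε + K * ε ^ 2) ^ 2 := by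
    calc _ = (1 - (B * ε ^ 2) ^ 2) * (Real.pi * (1 / ε ^ 2 - 1 / ρ ^ 2) + Real.pi * ‖b‖ ^ 2 * (ρ ^ 2 - ε ^ 2)) := by
          rw [← hBdef]; ring
      _ ≤ _ := h10
      _ = _ := by ring
  exact le_of_mul_le_mul_left h11 hpos

lemma koebe_area (b : ℂ) (s : ℂ → ℂ) (hs : DifferentiableOn ℂ s (ball 0 1))
    (hinj : InjOn (fun z => 1 / z + b * z + z ^ 2 * s z) (ball 0 1 \ {0})) : ‖b‖ ≤ 1 := by
  have h1 : ∀ ρ : ℝ, 0 < ρ → ρ < 1 → ‖b‖ ^ 2 * ρ ^ 4 ≤ 1 := by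
    intro ρ hρ0 hρ
    obtain ⟨K, hK, δ, hδ, H⟩ := koebe_area_ineq b s hs hinj hρ0 hρ
    set B := ‖b‖ with hB
    have h2 : ∀ ε : ℝ, 0 < ε → ε < δ → 0 ≤ 2 * K * ε + K ^ 2 * ε ^ 4 + B ^ 2 * ε ^ 2 +
        (1 - B ^ 2 * ε ^ 4) * (1 / ρ ^ 2 - B ^ 2 * ρ ^ 2 + B ^ 2 * ε ^ 2) := by
      intro ε hε hεδ
      have h3 := H ε hε hεδ
      have h4 : (1 / ε + K * ε ^ 2) ^ 2 - (1 - B ^ 2 * ε ^ 4) * ((1 / ε ^ 2 - 1 / ρ ^ 2) + B ^ 2 * (ρ ^ 2 - ε ^ 2))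
        = 2 * K * ε + K ^ 2 * ε ^ 4 + B ^ 2 * ε ^ 2 +
        (1 - B ^ 2 * ε ^ 4) * (1 / ρ ^ 2 - B ^ 2 * ρ ^ 2 + B ^ 2 * ε ^ 2) := by
        field_simp
        ring
      linarith
    have hc : Continuous fun ε : ℝ => 2 * K * ε + K ^ 2 * ε ^ 4 + B ^ 2 * ε ^ 2 +
        (1 - B ^ 2 * ε ^ 4) * (1 / ρ ^ 2 - B ^ 2 * ρ ^ 2 + B ^ 2 * ε ^ 2) := by fun_prop
    have ht := (hc.tendsto 0).mono_left (nhdsWithin_le_nhds (s := Ioi (0:ℝ)))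
    have h5 := ge_of_tendsto ht (by
      filter_upwards [Ioo_mem_nhdsGT hδ] with ε hε
      exact h2 ε hε.1 hε.2)
    have h6 : 0 ≤ 1 / ρ ^ 2 - B ^ 2 * ρ ^ 2 := by simpa using h5
    have h7 : 0 ≤ (1 / ρ ^ 2 - B ^ 2 * ρ ^ 2) * ρ ^ 2 := by positivity
    have h8 : (1 / ρ ^ 2 - B ^ 2 * ρ ^ 2) * ρ ^ 2 = 1 - B ^ 2 * ρ ^ 4 := by field_simp
    linarith
  have hc : Continuous fun ρ : ℝ => ‖b‖ ^ 2 * ρ ^ 4 := by fun_prop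
  have ht := (hc.tendsto 1).mono_left (nhdsWithin_le_nhds (s := Iio (1:ℝ)))
  have h5 := le_of_tendsto ht (by
      filter_upwards [Ioo_mem_nhdsLT (zero_lt_one (α := ℝ))] with ρ hρ
      exact h1 ρ hρ.1 hρ.2)
  have h6 : ‖b‖ ^ 2 ≤ 1 := by simpa using h5
  nlinarith [norm_nonneg b]

lemma koebe_log (φ : ℂ → ℂ) (hφ : DifferentiableOn ℂ φ (ball 0 1)) (h0 : ∀ z ∈ ball (0:ℂ) 1, φ z ≠ 0) :
    ∃ l : ℂ → ℂ, (∀ z ∈ ball (0:ℂ) 1, HasDerivAt l (deriv φ z / φ z) z) ∧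
      ∀ z ∈ ball (0:ℂ) 1, Complex.exp (l z) = φ z := by
  have h1 : DifferentiableOn ℂ (fun z => deriv φ z / φ z) (ball 0 1) :=
    (hφ.deriv isOpen_ball).div hφ h0
  obtain ⟨l, hl0, hl⟩ := h1.isExactOn_ball.with_val_at 0 (Complex.log (φ 0))
  refine ⟨l, hl, ?_⟩
  have hz0 : (0:ℂ) ∈ ball (0:ℂ) 1 := by simp
  have hd : ∀ z ∈ ball (0:ℂ) 1, HasDerivAt (fun z => φ z * Complex.exp (-l z)) 0 z := by
    intro z hz
    have h2 := (hφ.differentiableAt (isOpen_ball.mem_nhds hz)).hasDerivAt.mul ((hl z hz).neg.cexp)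
    convert! h2 using 1
    have := h0 z hz
    simp
    field_simp
    ring
  intro z hz
  have hc := (convex_ball (0:ℂ) 1).is_const_of_fderivWithin_eq_zero (𝕜 := ℂ)
    (f := fun z => φ z * Complex.exp (-l z))
    (fun z hz => (hd z hz).differentiableAt.differentiableWithinAt)
    (fun z hz => by
      rw [fderivWithin_of_isOpen isOpen_ball hz, (hd z hz).hasFDerivAt.fderiv]; ext; simp) hz hz0
  simp only [hl0, Complex.exp_neg, Complex.exp_log (h0 0 hz0), mul_inv_cancel₀ (h0 0 hz0)] at hc
  have hne := Complex.exp_ne_zero (l z)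
  field_simp at hc
  exact hc.symm

lemma koebe_bieberbach (φ : ℂ → ℂ) (hφ : DifferentiableOn ℂ φ (ball 0 1))
    (h0 : ∀ z ∈ ball (0:ℂ) 1, φ z ≠ 0) (hinj : InjOn (fun z => z * φ z) (ball 0 1)) :
    ‖deriv φ 0‖ ≤ 2 * ‖φ 0‖ := by
  obtain ⟨l, hl, hexp⟩ := koebe_log φ hφ h0
  have hz0 : (0:ℂ) ∈ ball (0:ℂ) 1 := by simp
  have hnhds : ball (0:ℂ) 1 ∈ nhds (0:ℂ) := isOpen_ball.mem_nhds hz0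
  set χ : ℂ → ℂ := fun z => Complex.exp (-(l z - l 0) / 2) with hχ
  have hχ0 : χ 0 = 1 := by simp [hχ]
  have hχn : ∀ z, χ z ≠ 0 := fun z => Complex.exp_ne_zero _
  have hχd : ∀ z ∈ ball (0:ℂ) 1, HasDerivAt χ (χ z * (-(deriv φ z / φ z) / 2)) z := by
    intro z hz
    exact (((hl z hz).sub_const (l 0)).neg.div_const 2).cexp
  have hχ2 : ∀ z ∈ ball (0:ℂ) 1, χ z ^ 2 * φ z = φ 0 := by
    intro z hz
    rw [← hexp z hz, ← hexp 0 hz0, hχ]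
    simp only
    rw [← Complex.exp_nat_mul, ← Complex.exp_add]
    congr 1; push_cast; ring
  set b := deriv χ 0 with hb
  have hb' : b = -(deriv φ 0 / φ 0) / 2 := by rw [hb, (hχd 0 hz0).deriv, hχ0, one_mul]
  have hχD : DifferentiableOn ℂ χ (ball 0 1) := fun z hz => (hχd z hz).differentiableAt.differentiableWithinAt
  set χa := dslope χ 0 with hχa
  have hχaD : DifferentiableOn ℂ χa (ball 0 1) := (Complex.differentiableOn_dslope hnhds).2 hχD
  set ω := dslope χa 0 with hω
  have hωD : DifferentiableOn ℂ ω (ball 0 1) := (Complex.differentiableOn_dslope hnhds).2 hχaD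
  have hexpand : ∀ z, χ z = 1 + b * z + z ^ 2 * ω z := by
    intro z
    have e1 := sub_smul_dslope χ 0 z
    have e2 := sub_smul_dslope χa 0 z
    rw [← hχa, hχ0, sub_zero, smul_eq_mul] at e1
    rw [← hω, sub_zero, smul_eq_mul, hχa, dslope_same, ← hχa, ← hb] at e2
    linear_combination (-1) * e1 - z * e2
  have hsq : ∀ z ∈ ball (0:ℂ) 1, z ^ 2 ∈ ball (0:ℂ) 1 := by
    intro z hz
    simp only [mem_ball, dist_zero_right, norm_pow] at hz ⊢
    exact pow_lt_one₀ (norm_nonneg _) hz (by norm_num)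
  have hsD : DifferentiableOn ℂ (fun z => z * ω (z ^ 2)) (ball 0 1) := by
    apply differentiableOn_id.mul
    exact hωD.comp (by fun_prop) hsq
  have hmain := koebe_area b (fun z => z * ω (z ^ 2)) hsD (by
    have hform : ∀ z : ℂ, z ≠ 0 → 1 / z + b * z + z ^ 2 * (z * ω (z ^ 2)) = χ (z ^ 2) / z := by
      intro z hz
      rw [hexpand]; field_simp
    rintro z ⟨hz, hzn⟩ w ⟨hw, hwn⟩ hzw
    simp only [mem_singleton_iff] at hzn hwn
    simp only [hform z hzn, hform w hwn] at hzw
    have e1 : χ (z ^ 2) * w = χ (w ^ 2) * z := by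
      field_simp at hzw; linear_combination hzw
    have e2 := hχ2 _ (hsq z hz)
    have e3 := hχ2 _ (hsq w hw)
    have e4 : z ^ 2 * φ (z ^ 2) = w ^ 2 * φ (w ^ 2) := by
      have h5 := h0 0 hz0
      have e5 : (χ (z ^ 2)) ^ 2 * w ^ 2 = χ (w ^ 2) ^ 2 * z ^ 2 := by
        rw [← mul_pow, ← mul_pow, e1]
      have h6 : φ 0 * (z ^ 2 * φ (z ^ 2)) = φ 0 * (w ^ 2 * φ (w ^ 2)) := by
        linear_combination (-φ (z ^ 2) * φ (w ^ 2)) * e5 - z ^ 2 * φ (z ^ 2) * e3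
          + w ^ 2 * φ (w ^ 2) * e2
      exact mul_left_cancel₀ h5 h6
    have e5 : z ^ 2 = w ^ 2 := hinj (hsq z hz) (hsq w hw) e4
    rw [e5] at e1
    exact (mul_left_cancel₀ (hχn _) e1).symm)
  have hφ0 : 0 < ‖φ 0‖ := norm_pos_iff.2 (h0 0 hz0)
  rw [hb'] at hmain
  simp only [norm_div, norm_neg, Complex.norm_ofNat] at hmain
  rw [div_le_iff₀ (by norm_num), div_le_iff₀ hφ0] at hmain
  linarith

lemma koebe_quarter_aux (φ : ℂ → ℂ) (hφ : DifferentiableOn ℂ φ (ball 0 1))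
    (h0 : ∀ z ∈ ball (0:ℂ) 1, φ z ≠ 0) (hinj : InjOn (fun z => z * φ z) (ball 0 1))
    (w : ℂ) (hw : ∀ z ∈ ball (0:ℂ) 1, z * φ z ≠ w) : ‖φ 0‖ ≤ 4 * ‖w‖ := by
  have hz0 : (0:ℂ) ∈ ball (0:ℂ) 1 := by simp
  have hw0 : w ≠ 0 := by
    have := hw 0 hz0
    simpa [eq_comm] using this
  have hden : ∀ z ∈ ball (0:ℂ) 1, w - z * φ z ≠ 0 := fun z hz => sub_ne_zero.2 (hw z hz).symm
  set φ2 : ℂ → ℂ := fun z => φ z / (w - z * φ z) with hφ2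
  have hdd : DifferentiableOn ℂ (fun z => w - z * φ z) (ball 0 1) :=
    (differentiableOn_const w).sub (differentiableOn_id.mul hφ)
  have h1 := koebe_bieberbach φ hφ h0 hinj
  have h2 := koebe_bieberbach φ2 (hφ.div hdd hden) (fun z hz => div_ne_zero (h0 z hz) (hden z hz)) (by
    intro z hz y hy hzy
    apply hinj hz hy
    have hz' := hden z hz
    have hy' := hden y hy
    simp only [hφ2] at hzy
    rw [← mul_div_assoc, ← mul_div_assoc, div_eq_div_iff hz' hy'] at hzy
    apply mul_left_cancel₀ hw0
    linear_combination hzy)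
  have hd := (hφ.differentiableAt (isOpen_ball.mem_nhds hz0)).hasDerivAt
  have hd2 := hd.div (((hasDerivAt_id (0:ℂ)).mul hd).const_sub w) (by simpa using hw0)
  have e1 : deriv φ2 0 = deriv φ 0 / w + φ 0 ^ 2 / w ^ 2 := by
    rw [HasDerivAt.deriv (f := φ2) hd2]
    simp
    field_simp
  have e2 : φ2 0 = φ 0 / w := by simp [hφ2]
  have hφ0 : 0 < ‖φ 0‖ := norm_pos_iff.2 (h0 0 hz0)
  have hwp : 0 < ‖w‖ := norm_pos_iff.2 hw0
  rw [e1, e2, norm_div] at h2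
  have h3 : ‖φ 0 ^ 2 / w ^ 2‖ ≤ 2 * (‖φ 0‖ / ‖w‖) + 2 * ‖φ 0‖ / ‖w‖ := by
    calc _ = ‖(deriv φ 0 / w + φ 0 ^ 2 / w ^ 2) - deriv φ 0 / w‖ := by congr 1; ring
      _ ≤ _ := norm_sub_le _ _
      _ ≤ _ := by
        gcongr
        rw [norm_div]
        gcongr
  rw [norm_div, norm_pow, norm_pow] at h3
  have h4 : 2 * (‖φ 0‖ / ‖w‖) + 2 * ‖φ 0‖ / ‖w‖ = (4 * ‖w‖) * ‖φ 0‖ / ‖w‖ ^ 2 := by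
    field_simp; ring
  rw [h4, div_le_div_iff_of_pos_right (by positivity), sq] at h3
  exact le_of_mul_le_mul_right h3 hφ0

lemma koebe_deriv_ne_zero (f : ℂ → ℂ) (z₀ : ℂ) (U : Set ℂ) (hU : U ∈ nhds z₀) (hf : DifferentiableOn ℂ f U)
    (hinj : InjOn f U) : deriv f z₀ ≠ 0 := by
  have hfa : AnalyticAt ℂ f z₀ := hf.analyticAt hU
  have hga : AnalyticAt ℂ (fun z => f z - f z₀) z₀ := hfa.sub analyticAt_const
  have hnt : analyticOrderAt (fun z => f z - f z₀) z₀ ≠ ⊤ := by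
    rw [Ne, analyticOrderAt_eq_top]
    intro h
    have h1 : ∀ᶠ z in nhds z₀, z = z₀ := by
      filter_upwards [h, hU] with z hz hzU
      exact hinj hzU (mem_of_mem_nhds hU) (sub_eq_zero.1 hz)
    have h2 : ∀ᶠ z in nhdsWithin z₀ {z₀}ᶜ, False := by
      filter_upwards [h1.filter_mono nhdsWithin_le_nhds, self_mem_nhdsWithin] with z hz hz2
      exact hz2 hz
    simp only [Filter.eventually_false_iff_eq_bot] at h2
    exact (inferInstance : (nhdsWithin z₀ {z₀}ᶜ).NeBot).ne h2
  obtain ⟨F, hF, hF0, hfF⟩ := hga.analyticOrderAt_ne_top.1 hnt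
  set n := analyticOrderNatAt (fun z => f z - f z₀) z₀ with hn
  have hn0 : n ≠ 0 := by
    intro h
    have := hfF.self_of_nhds
    rw [h] at this
    simp at this
    exact hF0 this.symm
  set k : ℂ → ℂ := fun z => (z - z₀) * Complex.exp (Complex.log (F z / F z₀) / n) with hk
  have hnC : (n:ℂ) ≠ 0 := by exact_mod_cast hn0
  have hka : AnalyticAt ℂ k z₀ := by
    have h1 : AnalyticAt ℂ (fun z => Complex.log (F z / F z₀)) z₀ := by
      apply AnalyticAt.clog (hF.div analyticAt_const hF0)
      simp [div_self hF0]
    exact (analyticAt_id.sub analyticAt_const).mul ((h1.div analyticAt_const hnC).cexp)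
  have hkd : HasDerivAt k 1 z₀ := by
    have h1 : DifferentiableAt ℂ (fun z => Complex.exp (Complex.log (F z / F z₀) / n)) z₀ := by
      have h1 : AnalyticAt ℂ (fun z => Complex.log (F z / F z₀)) z₀ := by
        apply AnalyticAt.clog (hF.div analyticAt_const hF0)
        simp [div_self hF0]
      exact ((h1.div analyticAt_const hnC).cexp).differentiableAt
    have h2 := ((hasDerivAt_id z₀).sub_const z₀).mul h1.hasDerivAt
    convert! h2 using 1
    simp [div_self hF0]
  have hks : HasStrictDerivAt k 1 z₀ := by
    have := hka.hasStrictDerivAt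
    rwa [hkd.deriv] at this
  have hmap := hks.map_nhds_eq (by norm_num)
  have hk0 : k z₀ = 0 := by simp [hk]
  rw [hk0] at hmap
  have hgood : ∀ᶠ z in nhds z₀, z ∈ U ∧ f z - f z₀ = F z₀ * k z ^ n := by
    filter_upwards [hU, hfF, hF.continuousAt.eventually_ne hF0] with z h1 h2 h3
    refine ⟨h1, ?_⟩
    rw [h2, hk]
    simp only [mul_pow, smul_eq_mul]
    rw [← Complex.exp_nat_mul, mul_div_cancel₀ _ hnC, Complex.exp_log (div_ne_zero h3 hF0)]
    field_simp
  have him : k '' {z | z ∈ U ∧ f z - f z₀ = F z₀ * k z ^ n} ∈ nhds (0:ℂ) := by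
    rw [← hmap]
    exact Filter.image_mem_map hgood
  obtain ⟨η, hη, hball⟩ := Metric.mem_nhds_iff.1 him
  have hω := Complex.isPrimitiveRoot_exp n hn0
  set ω := Complex.exp (2 * Real.pi * Complex.I / n) with hωd
  have hδ : (((η / 2 : ℝ)) : ℂ) ≠ 0 := by
    have : η / 2 ≠ 0 := by positivity
    exact_mod_cast this
  have hωn : ‖ω‖ = 1 := hω.norm'_eq_one hn0
  obtain ⟨x, ⟨hxU, hx⟩, hxk⟩ := hball (show ((η / 2 : ℝ) : ℂ) ∈ ball (0:ℂ) η by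
    rw [mem_ball, dist_zero_right, Complex.norm_real, Real.norm_of_nonneg (by positivity)]; linarith)
  obtain ⟨y, ⟨hyU, hy⟩, hyk⟩ := hball (show ω * ((η / 2 : ℝ) : ℂ) ∈ ball (0:ℂ) η by
    rw [mem_ball, dist_zero_right, norm_mul, hωn, Complex.norm_real, Real.norm_of_nonneg (by positivity)]; linarith)
  have hxy : x = y := by
    apply hinj hxU hyU
    have : k x ^ n = k y ^ n := by rw [hxk, hyk, mul_pow, hω.pow_eq_one, one_mul]
    rw [← this, ← hx] at hy
    linear_combination -hy
  rw [hxy, hyk] at hxk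
  have hω1 : ω = 1 := by
    apply mul_right_cancel₀ hδ
    rw [hxk, one_mul]
  have hn1 : n = 1 := by
    rw [hω1] at hω
    exact hω.eq_orderOf.trans orderOf_one
  have hd : HasDerivAt (fun z => F z₀ * k z ^ n + f z₀) (F z₀) z₀ := by
    rw [hn1]
    simp only [pow_one]
    simpa using (hkd.const_mul (F z₀)).add_const (f z₀)
  have hfd : HasDerivAt f (F z₀) z₀ := by
    apply hd.congr_of_eventuallyEq
    filter_upwards [hgood] with z hz
    rw [← hz.2]; ring
  rw [hfd.deriv]
  exact hF0

lemma koebe_quarter (F : ℂ → ℂ) (hF : DifferentiableOn ℂ F (ball 0 1)) (hinj : InjOn F (ball 0 1))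
    (w : ℂ) (hw : ∀ z ∈ ball (0:ℂ) 1, F z ≠ w) : ‖deriv F 0‖ ≤ 4 * ‖w - F 0‖ := by
  have hz0 : (0:ℂ) ∈ ball (0:ℂ) 1 := by simp
  have hnhds : ball (0:ℂ) 1 ∈ nhds (0:ℂ) := isOpen_ball.mem_nhds hz0
  have hd0 := koebe_deriv_ne_zero F 0 _ hnhds hF hinj
  have he : ∀ z, z * dslope F 0 z = F z - F 0 := by
    intro z
    simpa using sub_smul_dslope F 0 z
  have h := koebe_quarter_aux (dslope F 0) ((Complex.differentiableOn_dslope hnhds).2 hF) (by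
      intro z hz h
      by_cases hzz : z = 0
      · rw [hzz, dslope_same] at h; exact hd0 h
      · have := he z
        rw [h, mul_zero] at this
        exact hzz (hinj hz hz0 (sub_eq_zero.1 this.symm))) (by
      intro z hz y hy hzy
      simp only [he] at hzy
      exact hinj hz hy (by linear_combination hzy)) (w - F 0) (by
      intro z hz h
      rw [he] at h
      exact hw z hz (by linear_combination h))
  rwa [dslope_same] at h

lemma koebe_alg (a z p d τ : ℂ) (hτ : τ ≠ 0) (hz : z = τ * a) (hz0 : z ≠ 0) (hp : p ≠ 0) :
    a * (d / p) = (z * (p + z * d) / (z * p) - 1) / τ := by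
  have ha : a = z / τ := by rw [hz]; field_simp
  rw [ha]
  field_simp
  ring

/-- The conformal map of the disk onto the disk minus the slit `(-1, -r]`. -/
lemma koebe_slit_map {r : ℝ} (hr : 0 < r) (hr1 : r < 1) :
    ∃ k : ℂ → ℂ, DifferentiableOn ℂ k (ball 0 1) ∧ InjOn k (ball 0 1) ∧ MapsTo k (ball 0 1) (ball 0 1) ∧
      k 0 = 0 ∧ HasDerivAt k ((4 * r / (1 + r) ^ 2 : ℝ) : ℂ) 0 ∧ ∀ z ∈ ball (0:ℂ) 1, k z ≠ -r := by
  set t : ℝ := 4 * r / (1 + r) ^ 2 with ht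
  have ht0 : 0 < t := by positivity
  have ht1 : 1 - t = ((1 - r) / (1 + r)) ^ 2 := by rw [ht]; field_simp; ring
  have ht2 : 0 < 1 - t := by
    rw [ht1]
    have : 0 < 1 - r := by linarith
    positivity
  set u : ℂ → ℂ := fun z => (1 + z) / (1 - z) with hu
  set S : ℂ → ℂ := fun z => (1 - t : ℝ) + (t : ℝ) * u z ^ 2 with hS
  set v : ℂ → ℂ := fun z => Complex.exp (Complex.log (S z) / 2) with hv
  have hz1 : ∀ z ∈ ball (0:ℂ) 1, 1 - z ≠ 0 := by
    intro z hz h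
    have : z = 1 := by linear_combination -h
    simp [this] at hz
  have hure : ∀ z ∈ ball (0:ℂ) 1, 0 < (u z).re := by
    intro z hz
    have h1 : ‖z‖ ^ 2 < 1 := by
      have : ‖z‖ < 1 := by simpa using hz
      exact pow_lt_one₀ (norm_nonneg _) this (by norm_num)
    have h2 := Complex.normSq_pos.2 (hz1 z hz)
    rw [← Complex.normSq_eq_norm_sq, Complex.normSq_apply] at h1
    simp only [hu, Complex.div_re]
    rw [← add_div]
    apply div_pos _ h2
    simp
    nlinarith
  have hSslit : ∀ z ∈ ball (0:ℂ) 1, S z ∈ Complex.slitPlane := by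
    intro z hz
    have h1 := hure z hz
    rw [Complex.mem_slitPlane_iff]
    by_cases him : (u z).im = 0
    · left
      have : (S z).re = (1 - t) + t * (u z).re ^ 2 := by
        simp [hS, sq, him]
      rw [this]; positivity
    · right
      have : (S z).im = t * (2 * (u z).re * (u z).im) := by
        simp [hS, sq]; left; ring
      rw [this]
      exact mul_ne_zero ht0.ne' (mul_ne_zero (mul_ne_zero two_ne_zero h1.ne') him)
  have hv2 : ∀ z ∈ ball (0:ℂ) 1, v z ^ 2 = S z := by
    intro z hz
    rw [hv]
    simp only
    rw [← Complex.exp_nat_mul, Nat.cast_ofNat, mul_div_cancel₀ _ two_ne_zero, Complex.exp_log (Complex.slitPlane_ne_zero (hSslit z hz))]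
  have hvre : ∀ z ∈ ball (0:ℂ) 1, 0 < (v z).re := by
    intro z hz
    have h1 := Complex.mem_slitPlane_iff_arg.1 (hSslit z hz)
    have h2 := Complex.arg_le_pi (S z)
    have h3 := Complex.neg_pi_lt_arg (S z)
    have h4 : Complex.arg (S z) < Real.pi := lt_of_le_of_ne h2 h1.1
    rw [hv]
    simp only [Complex.exp_re]
    apply mul_pos (Real.exp_pos _)
    have : (Complex.log (S z) / 2).im = Complex.arg (S z) / 2 := by
      rw [show (2:ℂ) = ((2:ℝ):ℂ) by norm_num, Complex.div_ofReal_im, Complex.log_im]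
    rw [this]
    apply Real.cos_pos_of_mem_Ioo
    constructor <;> linarith
  have hv1 : ∀ z ∈ ball (0:ℂ) 1, v z + 1 ≠ 0 := by
    intro z hz h
    have h1 := hvre z hz
    have : v z = -1 := by linear_combination h
    rw [this] at h1
    norm_num at h1
  have hud : ∀ z ∈ ball (0:ℂ) 1, HasDerivAt u (2 / (1 - z) ^ 2) z := by
    intro z hz
    have h1 := ((hasDerivAt_id z).const_add 1).div ((hasDerivAt_id z).const_sub 1) (hz1 z hz)
    convert! h1 using 1
    simp
    ring
  have hSd : ∀ z ∈ ball (0:ℂ) 1, HasDerivAt S (t * (2 * u z * (2 / (1 - z) ^ 2))) z := by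
    intro z hz
    have h1 := (((hud z hz).pow 2).const_mul (t:ℂ)).const_add ((1 - t : ℝ) : ℂ)
    convert! h1 using 1
    simp
  have hvd : ∀ z ∈ ball (0:ℂ) 1, HasDerivAt v (v z * ((t * (2 * u z * (2 / (1 - z) ^ 2))) / S z / 2)) z := by
    intro z hz
    exact (((hSd z hz).clog (hSslit z hz)).div_const 2).cexp
  have hz0 : (0:ℂ) ∈ ball (0:ℂ) 1 := by simp
  have hu0 : u 0 = 1 := by simp [hu]
  have hS0 : S 0 = 1 := by simp [hS, hu0]
  have hv0 : v 0 = 1 := by simp [hv, hS0]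
  have hkd : ∀ z ∈ ball (0:ℂ) 1, HasDerivAt (fun z => (v z - 1) / (v z + 1)) _ z := fun z hz =>
    ((hvd z hz).sub_const 1).div ((hvd z hz).add_const 1) (hv1 z hz)
  refine ⟨fun z => (v z - 1) / (v z + 1), ?_, ?_, ?_, ?_, ?_, ?_⟩
  · intro z hz
    exact (hkd z hz).differentiableAt.differentiableWithinAt
  · intro z hz y hy hzy
    simp only at hzy
    rw [div_eq_div_iff (hv1 z hz) (hv1 y hy)] at hzy
    have e1 : v z = v y := by linear_combination hzy / 2
    have e2 : S z = S y := by rw [← hv2 z hz, ← hv2 y hy, e1]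
    have htC : (t:ℂ) ≠ 0 := by exact_mod_cast ht0.ne'
    have e3 : u z ^ 2 = u y ^ 2 := by
      apply mul_left_cancel₀ htC
      simp only [hS] at e2
      linear_combination e2
    have e4 : u z = u y := by
      rcases sq_eq_sq_iff_eq_or_eq_neg.1 e3 with h | h
      · exact h
      · have h1 := hure z hz
        have h2 := hure y hy
        rw [h, Complex.neg_re] at h1
        linarith
    simp only [hu] at e4
    rw [div_eq_div_iff (hz1 z hz) (hz1 y hy)] at e4
    linear_combination e4 / 2
  · intro z hz
    have h1 := hvre z hz
    simp only [mem_ball, dist_zero_right, norm_div]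
    rw [div_lt_one (norm_pos_iff.2 (hv1 z hz))]
    rw [← sq_lt_sq₀ (norm_nonneg _) (norm_nonneg _), ← Complex.normSq_eq_norm_sq, ← Complex.normSq_eq_norm_sq,
      Complex.normSq_apply, Complex.normSq_apply]
    simp
    nlinarith
  · simp [hv0]
  · have := hkd 0 hz0
    convert! this using 1
    rw [hv0, hS0, hu0]
    push_cast
    simp only [sub_self, sub_zero]
    ring
  · intro z hz h
    rw [div_eq_iff (hv1 z hz)] at h
    have hrC : (1 + r : ℂ) ≠ 0 := by
      have : (1 + r : ℝ) ≠ 0 := by positivity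
      exact_mod_cast this
    have e1 : v z = (((1 - r) / (1 + r) : ℝ) : ℂ) := by
      push_cast
      rw [eq_div_iff hrC]
      linear_combination h
    have e2 := hv2 z hz
    rw [e1, ← Complex.ofReal_pow, ← ht1] at e2
    simp only [hS] at e2
    have e3 : (t:ℂ) * u z ^ 2 = 0 := by linear_combination -e2
    have htC : (t:ℂ) ≠ 0 := by exact_mod_cast ht0.ne'
    have e4 : u z = 0 := by simpa [htC] using e3
    have := hure z hz
    rw [e4] at this
    simp at this

lemma koebe_growth_lower (F : ℂ → ℂ) (hF : DifferentiableOn ℂ F (ball 0 1)) (hinj : InjOn F (ball 0 1))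
    (a : ℂ) (ha : a ∈ ball (0:ℂ) 1) :
    ‖deriv F 0‖ * ‖a‖ ≤ (1 + ‖a‖) ^ 2 * ‖F a - F 0‖ := by
  by_cases ha0 : a = 0
  · simp [ha0]
  set r := ‖a‖ with hr
  have hr0 : 0 < r := norm_pos_iff.2 ha0
  have hr1 : r < 1 := by simpa using ha
  have hrC : (r:ℂ) ≠ 0 := by exact_mod_cast hr0.ne'
  have hz0 : (0:ℂ) ∈ ball (0:ℂ) 1 := by simp
  obtain ⟨k, hkD, hkI, hkM, hk0, hkd, hko⟩ := koebe_slit_map hr0 hr1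
  set c : ℂ := -(a / r) with hc
  have hcn : ‖c‖ = 1 := by
    rw [hc, norm_neg, norm_div, Complex.norm_real, Real.norm_of_nonneg hr0.le, ← hr, div_self hr0.ne']
  have hc0 : c ≠ 0 := by rw [← norm_pos_iff, hcn]; norm_num
  have hmaps : MapsTo (fun z => c * k z) (ball 0 1) (ball 0 1) := by
    intro z hz
    have := hkM hz
    simpa [hcn] using this
  have h := koebe_quarter (fun z => F (c * k z)) (hF.comp (hkD.const_mul c) hmaps) (by
      intro z hz y hy hzy
      exact hkI hz hy (mul_left_cancel₀ hc0 (hinj (hmaps hz) (hmaps hy) hzy))) (F a) (by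
      intro z hz h
      have h1 : c * k z = a := hinj (hmaps hz) ha h
      apply hko z hz
      apply mul_left_cancel₀ hc0
      rw [h1, hc]
      field_simp)
  have hFd : HasDerivAt F (deriv F 0) (c * k 0) := by
    rw [hk0, mul_zero]
    exact (hF.differentiableAt (isOpen_ball.mem_nhds hz0)).hasDerivAt
  have hd := hFd.comp 0 (hkd.const_mul c)
  have hd' : deriv (fun z => F (c * k z)) 0 = _ := hd.deriv
  rw [hd', hk0, mul_zero, norm_mul, norm_mul, hcn, Complex.norm_real, Real.norm_of_nonneg (by positivity)] at h
  have h2 : ‖deriv F 0‖ * (1 * (4 * r / (1 + r) ^ 2)) = 4 * (‖deriv F 0‖ * r / (1 + r) ^ 2) := by ring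
  rw [h2] at h
  have h3 : ‖deriv F 0‖ * r / (1 + r) ^ 2 ≤ ‖F a - F 0‖ := by linarith
  rwa [div_le_iff₀ (by positivity), mul_comm _ ((1 + r) ^ 2)] at h3

lemma koebe_deriv_upper (F : ℂ → ℂ) (hF : DifferentiableOn ℂ F (ball 0 1)) (hinj : InjOn F (ball 0 1))
    (a : ℂ) (ha : a ∈ ball (0:ℂ) 1) :
    ‖deriv F a‖ * ((1 - ‖a‖) * ‖a‖) ≤ (1 + ‖a‖) * ‖F a - F 0‖ := by
  have hr1 : ‖a‖ < 1 := by simpa using ha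
  have hr0 := norm_nonneg a
  have hz0 : (0:ℂ) ∈ ball (0:ℂ) 1 := by simp
  have hden : ∀ z ∈ ball (0:ℂ) 1, 1 + starRingEnd ℂ a * z ≠ 0 := by
    intro z hz h
    have h1 : starRingEnd ℂ a * z = -1 := by linear_combination h
    have h2 := congrArg norm h1
    rw [norm_mul, RCLike.norm_conj, norm_neg, norm_one] at h2
    have h3 : ‖z‖ < 1 := by simpa using hz
    nlinarith [norm_nonneg z]
  set m : ℂ → ℂ := fun z => (z + a) / (1 + starRingEnd ℂ a * z) with hm
  have hmd : ∀ z ∈ ball (0:ℂ) 1, HasDerivAt m ((1 - ‖a‖ ^ 2) / (1 + starRingEnd ℂ a * z) ^ 2) z := by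
    intro z hz
    have h1 := ((hasDerivAt_id z).add_const a).div (((hasDerivAt_id z).const_mul (starRingEnd ℂ a)).const_add 1) (hden z hz)
    convert! h1 using 1
    rw [← Complex.mul_conj']
    simp
    ring
  have hmaps : MapsTo m (ball 0 1) (ball 0 1) := by
    intro z hz
    have h3 : ‖z‖ < 1 := by simpa using hz
    simp only [hm, mem_ball, dist_zero_right, norm_div]
    rw [div_lt_one (norm_pos_iff.2 (hden z hz)), ← sq_lt_sq₀ (norm_nonneg _) (norm_nonneg _),
      ← Complex.normSq_eq_norm_sq, ← Complex.normSq_eq_norm_sq]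
    have h4 : Complex.normSq (1 + starRingEnd ℂ a * z) - Complex.normSq (z + a) =
        (1 - Complex.normSq a) * (1 - Complex.normSq z) := by
      simp [Complex.normSq_apply]; ring
    have h5 : 0 < (1 - Complex.normSq a) * (1 - Complex.normSq z) := by
      rw [Complex.normSq_eq_norm_sq, Complex.normSq_eq_norm_sq]
      apply mul_pos <;> nlinarith [norm_nonneg z]
    linarith
  have hasq : (1 - ‖a‖ ^ 2 : ℂ) ≠ 0 := by
    have : (1 - ‖a‖ ^ 2 : ℝ) ≠ 0 := by nlinarith
    exact_mod_cast this
  have hmi : InjOn m (ball 0 1) := by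
    intro z hz y hy hzy
    simp only [hm] at hzy
    rw [div_eq_div_iff (hden z hz) (hden y hy)] at hzy
    apply mul_left_cancel₀ hasq
    rw [← Complex.mul_conj']
    linear_combination hzy
  have h := koebe_growth_lower (fun z => F (m z))
    (hF.comp (fun z hz => (hmd z hz).differentiableAt.differentiableWithinAt) hmaps)
    (fun z hz y hy hzy => hmi hz hy (hinj (hmaps hz) (hmaps hy) hzy)) (-a) (by simpa using ha)
  have hm0 : m 0 = a := by simp [hm]
  have hma : m (-a) = 0 := by simp [hm]
  have hFd : HasDerivAt F (deriv F a) (m 0) := by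
    rw [hm0]
    exact (hF.differentiableAt (isOpen_ball.mem_nhds ha)).hasDerivAt
  have hd' : deriv (fun z => F (m z)) 0 = _ := (hFd.comp 0 (hmd 0 hz0)).deriv
  have hnn : ‖(1 - ‖a‖ ^ 2 : ℂ) / (1 + starRingEnd ℂ a * 0) ^ 2‖ = 1 - ‖a‖ ^ 2 := by
    rw [mul_zero, add_zero, one_pow, div_one]
    have : (1 - ‖a‖ ^ 2 : ℂ) = ((1 - ‖a‖ ^ 2 : ℝ) : ℂ) := by push_cast; rfl
    rw [this, Complex.norm_real, Real.norm_of_nonneg (by nlinarith)]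
  rw [hd', hm0, hma, norm_mul, hnn, norm_neg, norm_sub_rev] at h
  have h6 : (1 + ‖a‖) * (‖deriv F a‖ * ((1 - ‖a‖) * ‖a‖)) ≤ (1 + ‖a‖) * ((1 + ‖a‖) * ‖F a - F 0‖) := by
    nlinarith
  exact le_of_mul_le_mul_left h6 (by positivity)

lemma koebe_growth_upper (F : ℂ → ℂ) (hF : DifferentiableOn ℂ F (ball 0 1)) (hinj : InjOn F (ball 0 1))
    (a : ℂ) (ha : a ∈ ball (0:ℂ) 1) :
    (1 - ‖a‖) ^ 2 * ‖F a - F 0‖ ≤ ‖deriv F 0‖ * ‖a‖ := by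
  by_cases ha0 : a = 0
  · simp [ha0]
  set r := ‖a‖ with hr
  have hr0 : 0 < r := norm_pos_iff.2 ha0
  have hr1 : r < 1 := by simpa using ha
  have hz0 : (0:ℂ) ∈ ball (0:ℂ) 1 := by simp
  have hnhds : ball (0:ℂ) 1 ∈ nhds (0:ℂ) := isOpen_ball.mem_nhds hz0
  have hd0 := koebe_deriv_ne_zero F 0 _ hnhds hF hinj
  set φ := dslope F 0 with hφ
  have he : ∀ z, z * φ z = F z - F 0 := by
    intro z
    simpa using sub_smul_dslope F 0 z
  have hφD : DifferentiableOn ℂ φ (ball 0 1) := (Complex.differentiableOn_dslope hnhds).2 hF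
  have hφ0 : ∀ z ∈ ball (0:ℂ) 1, φ z ≠ 0 := by
    intro z hz h
    by_cases hzz : z = 0
    · rw [hzz, hφ, dslope_same] at h; exact hd0 h
    · have := he z
      rw [h, mul_zero] at this
      exact hzz (hinj hz hz0 (sub_eq_zero.1 this.symm))
  obtain ⟨l, hl, hexp⟩ := koebe_log φ hφD hφ0
  have hmem : ∀ t ∈ Icc (0:ℝ) 1, (t:ℂ) * a ∈ ball (0:ℂ) 1 := by
    intro t ht
    rw [mem_ball, dist_zero_right, norm_mul, Complex.norm_real, Real.norm_of_nonneg ht.1, ← hr]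
    nlinarith [ht.2]
  have hpos : ∀ t ∈ Icc (0:ℝ) 1, 0 < 1 - t * r := by
    intro t ht; nlinarith [ht.2]
  set g : ℝ → ℝ := fun t => (l (t * a)).re + 2 * Real.log (1 - t * r) with hg
  have hgd : ∀ t ∈ Icc (0:ℝ) 1, HasDerivAt g
      ((a * (deriv φ (t * a) / φ (t * a))).re + 2 * (-r / (1 - t * r))) t := by
    intro t ht
    have h1 : HasDerivAt (fun s : ℂ => l (s * a)) (deriv φ (t * a) / φ (t * a) * a) (t:ℂ) := by
      have := (hl _ (hmem t ht)).comp (t:ℂ) ((hasDerivAt_id (t:ℂ)).mul_const a)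
      rw [one_mul] at this
      exact this
    have h2 := h1.real_of_complex
    have h3 : HasDerivAt (fun s : ℝ => 1 - s * r) (-r) t := by
      simpa using ((hasDerivAt_id t).mul_const r).const_sub 1
    have h4 := (h3.log (hpos t ht).ne').const_mul 2
    rw [mul_comm a]
    exact h2.add h4
  have hanti : AntitoneOn g (Icc 0 1) := by
    apply antitoneOn_of_deriv_nonpos (convex_Icc 0 1)
    · intro t ht; exact (hgd t ht).continuousAt.continuousWithinAt
    · intro t ht
      rw [interior_Icc] at ht
      exact (hgd t (Ioo_subset_Icc_self ht)).differentiableAt.differentiableWithinAt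
    · intro t ht
      rw [interior_Icc] at ht
      have htI := Ioo_subset_Icc_self ht
      rw [(hgd t htI).deriv]
      set z : ℂ := t * a with hz
      have hzm := hmem t htI
      have htC : (t:ℂ) ≠ 0 := by exact_mod_cast ht.1.ne'
      have hzn : z ≠ 0 := mul_ne_zero htC ha0
      have hnz : ‖z‖ = t * r := by
        rw [hz, norm_mul, Complex.norm_real, Real.norm_of_nonneg ht.1.le]
      have hFz : F z - F 0 ≠ 0 := by
        rw [← he]; exact mul_ne_zero hzn (hφ0 z hzm)
      have hdF : deriv F z = φ z + z * deriv φ z := by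
        have h1 := ((hasDerivAt_id z).mul (hφD.differentiableAt (isOpen_ball.mem_nhds hzm)).hasDerivAt).add_const (F 0)
        have h2 : HasDerivAt F (1 * φ z + z * deriv φ z) z := by
          convert! h1 using 1
          ext y
          simp [he]
        rw [h2.deriv, one_mul]
      have e1 : a * (deriv φ z / φ z) = (z * deriv F z / (F z - F 0) - 1) / t := by
        rw [hdF, ← he]
        exact koebe_alg a z (φ z) (deriv φ z) t htC hz hzn (hφ0 z hzm)
      have hb := koebe_deriv_upper F hF hinj z hzm
      rw [hnz] at hb
      have hp := hpos t htI
      have e2 : (z * deriv F z / (F z - F 0)).re ≤ (1 + t * r) / (1 - t * r) := by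
        refine (Complex.re_le_norm _).trans ?_
        rw [norm_div, norm_mul, hnz, div_le_div_iff₀ (norm_pos_iff.2 hFz) hp]
        linarith
      rw [e1, Complex.div_ofReal_re, Complex.sub_re, Complex.one_re]
      have e3 : ((z * deriv F z / (F z - F 0)).re - 1) / t ≤ ((1 + t * r) / (1 - t * r) - 1) / t := by
        have := ht.1
        gcongr
      have e4 : ((1 + t * r) / (1 - t * r) - 1) / t = - (2 * (-r / (1 - t * r))) := by
        have := ht.1.ne'
        field_simp
        ring
      linarith
  have hfin := hanti (left_mem_Icc.2 zero_le_one) (right_mem_Icc.2 zero_le_one) zero_le_one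
  simp only [hg, Complex.ofReal_one, one_mul, Complex.ofReal_zero, zero_mul, sub_zero, Real.log_one, mul_zero,
    add_zero] at hfin
  have h1r : 0 < 1 - r := by linarith
  have h2 := Real.exp_le_exp.2 hfin
  rw [Real.exp_add, ← Complex.norm_exp, ← Complex.norm_exp, hexp a ha, hexp 0 hz0, two_mul, Real.exp_add,
    Real.exp_log h1r] at h2
  rw [← he a, norm_mul, ← hr]
  have h3 : φ 0 = deriv F 0 := by rw [hφ, dslope_same]
  rw [← h3]
  nlinarith

theorem deriv_bounds_of_image_dist_one (z₀ : ℂ) (R : ℝ) (hR : 0 < R) (Φ : ℂ → ℂ)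
    (hΦ : DifferentiableOn ℂ Φ (Metric.ball z₀ R))
    (hinj : Set.InjOn Φ (Metric.ball z₀ R))
    (w : ℂ) (hw : w ∈ Metric.ball z₀ R) (hwne : w ≠ z₀)
    (hone : ‖Φ w - Φ z₀‖ = 1) :
    (1 - ‖w - z₀‖ / R) ^ 2 / ‖w - z₀‖ ≤ ‖deriv Φ z₀‖ ∧
    ‖deriv Φ z₀‖ ≤ (1 + ‖w - z₀‖ / R) ^ 2 / ‖w - z₀‖ := by
  have hRC : (R:ℂ) ≠ 0 := by exact_mod_cast hR.ne'
  have hmaps : MapsTo (fun z : ℂ => z₀ + R * z) (ball 0 1) (ball z₀ R) := by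
    intro z hz
    have : ‖z‖ < 1 := by simpa using hz
    simp only [mem_ball, dist_self_add_left, norm_mul, Complex.norm_real, Real.norm_of_nonneg hR.le]
    nlinarith
  set F : ℂ → ℂ := fun z => Φ (z₀ + R * z) with hF
  have hFD : DifferentiableOn ℂ F (ball 0 1) := hΦ.comp (by fun_prop) hmaps
  have hFI : InjOn F (ball 0 1) := by
    intro z hz y hy hzy
    have := hinj (hmaps hz) (hmaps hy) hzy
    exact mul_left_cancel₀ hRC (add_left_cancel this)
  set a : ℂ := (w - z₀) / R with ha
  have han : ‖a‖ = ‖w - z₀‖ / R := by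
    rw [ha, norm_div, Complex.norm_real, Real.norm_of_nonneg hR.le]
  have hwp : 0 < ‖w - z₀‖ := norm_pos_iff.2 (sub_ne_zero.2 hwne)
  have ham : a ∈ ball (0:ℂ) 1 := by
    rw [mem_ball, dist_zero_right, han, div_lt_one hR]
    simpa [dist_eq_norm] using hw
  have hF0 : F 0 = Φ z₀ := by simp [hF]
  have hFa : F a = Φ w := by
    simp only [hF, ha]
    congr 1
    field_simp
    ring
  have hd : deriv F 0 = deriv Φ z₀ * R := by
    have h1 : HasDerivAt Φ (deriv Φ z₀) (z₀ + R * 0) := by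
      rw [mul_zero, add_zero]
      exact (hΦ.differentiableAt (isOpen_ball.mem_nhds (mem_ball_self hR))).hasDerivAt
    have h2 : HasDerivAt (fun z : ℂ => z₀ + R * z) (R:ℂ) 0 := by
      simpa using ((hasDerivAt_id (0:ℂ)).const_mul (R:ℂ)).const_add z₀
    exact (h1.comp 0 h2).deriv
  have hlow := koebe_growth_lower F hFD hFI a ham
  have hup := koebe_growth_upper F hFD hFI a ham
  have hdn : ‖deriv F 0‖ * ‖a‖ = ‖deriv Φ z₀‖ * ‖w - z₀‖ := by
    rw [hd, han, norm_mul, Complex.norm_real, Real.norm_of_nonneg hR.le]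
    field_simp
  rw [hdn, hFa, hF0, hone, mul_one, han] at hlow hup
  constructor
  · rwa [div_le_iff₀ hwp]
  · rwa [le_div_iff₀ hwp]
end
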